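/- arXiv:2305.16539 — 7 statements merged into one kernel-verified Lean document; each statement's English description precedes it below -/
import Mathlib

section
/- Let X and Y be Polish spaces and let μ = (μ_1,…,μ_d) and ν = (ν_1,…,ν_d) be d-tuples of finite nonzero Borel measures on X and Y respectively, and assume μ is jointly atomless. Then the set T(μ,ν) of simultaneous Monge transport maps is nonempty if and only if μ ⪰_h ν. -/
open MeasureTheory ProbabilityTheory ENNReal

noncomputable section

/-- `κ` is a simultaneous transport kernel from the tuple `μ` to the tuple `ν`:
it is a Markov kernel and `∫ κ(x,·) dμ_j ≥ ν_j` for every `j`. -/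
def IsSimulKernel {X Y : Type*} [MeasurableSpace X] [MeasurableSpace Y] {d : ℕ}
    (κ : Kernel X Y) (μ : Fin d → Measure X) (ν : Fin d → Measure Y) : Prop :=
  IsMarkovKernel κ ∧ ∀ j, ν j ≤ (μ j).bind (fun x => κ x)

/-- `T` is a simultaneous (Monge) transport map from `μ` to `ν`. -/
def IsSimulMap {X Y : Type*} [MeasurableSpace X] [MeasurableSpace Y] {d : ℕ}
    (T : X → Y) (μ : Fin d → Measure X) (ν : Fin d → Measure Y) : Prop :=
  Measurable T ∧ ∀ j, ν j ≤ (μ j).map T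

/-- The heterogeneity order `μ ⪰_h ν`: there are dominating probability measures whose
density vectors are comparable in the multivariate increasing convex order. -/
def HeteroOrder {X Y : Type*} [MeasurableSpace X] [MeasurableSpace Y] {d : ℕ}
    (μ : Fin d → Measure X) (ν : Fin d → Measure Y) : Prop :=
  ∃ (lam : Measure X) (rho : Measure Y) (g : X → Fin d → ℝ) (h : Y → Fin d → ℝ),
    IsProbabilityMeasure lam ∧ IsProbabilityMeasure rho ∧
    Measurable g ∧ Measurable h ∧
    (∀ j, μ j = lam.withDensity (fun x => ENNReal.ofReal (g x j))) ∧
    (∀ j, ν j = rho.withDensity (fun y => ENNReal.ofReal (h y j))) ∧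
    ∀ f : (Fin d → ℝ) → ℝ, ConvexOn ℝ Set.univ f → Monotone f →
      Integrable (fun x => f (g x)) lam → Integrable (fun y => f (h y)) rho →
      ∫ y, f (h y) ∂rho ≤ ∫ x, f (g x) ∂lam

/-- The tuple `μ` is jointly atomless: some dominating probability measure carries an
atomlessly distributed random variable independent of the density vector of `μ`. -/
def JointlyAtomless {X : Type*} [MeasurableSpace X] {d : ℕ}
    (μ : Fin d → Measure X) : Prop :=
  ∃ (lam : Measure X) (g : X → Fin d → ℝ) (ξ : X → ℝ),
    IsProbabilityMeasure lam ∧ Measurable g ∧ Measurable ξ ∧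
    (∀ j, μ j = lam.withDensity (fun x => ENNReal.ofReal (g x j))) ∧
    (∀ r : ℝ, lam (ξ ⁻¹' {r}) = 0) ∧
    IndepFun ξ g lam

/-- Normalized average of a tuple of measures. -/
def avg {X : Type*} [MeasurableSpace X] {d : ℕ} (μ : Fin d → Measure X) : Measure X :=
  ((∑ j, μ j) Set.univ)⁻¹ • ∑ j, μ j

/-- Transport cost of a kernel with respect to the reference measure `η`. -/
def kernelCost {X Y : Type*} [MeasurableSpace X] [MeasurableSpace Y]
    (c : X → Y → ℝ≥0∞) (η : Measure X) (κ : Kernel X Y) : ℝ≥0∞ :=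
  ∫⁻ x, ∫⁻ y, c x y ∂(κ x) ∂η

/-- The set `Π_η(μ,ν)` of transport plans `η ⊗ κ` with `κ ∈ K(μ,ν)`. -/
def PiSet {X Y : Type*} [MeasurableSpace X] [MeasurableSpace Y] {d : ℕ}
    (η : Measure X) (μ : Fin d → Measure X) (ν : Fin d → Measure Y) :
    Set (Measure (X × Y)) :=
  {π | ∃ κ : Kernel X Y, IsSimulKernel κ μ ν ∧ π = η.compProd κ}

/-- Kernel condition for a single pair of (possibly non-probability) measures. -/
def IsKernelLe {X Y : Type*} [MeasurableSpace X] [MeasurableSpace Y]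
    (κ : Kernel X Y) (α : Measure X) (β : Measure Y) : Prop :=
  IsMarkovKernel κ ∧ β ≤ α.bind (fun x => κ x)

/-- Classical (d = 1) optimal transport cost between two measures. -/
def OTCost {X Y : Type*} [MeasurableSpace X] [MeasurableSpace Y]
    (c : X → Y → ℝ≥0∞) (α : Measure X) (β : Measure Y) : ℝ≥0∞ :=
  ⨅ π ∈ {π : Measure (X × Y) | π.map Prod.fst = α ∧ π.map Prod.snd = β},
    ∫⁻ p, c p.1 p.2 ∂π

/-- `g` is a (Borel) version of the density vector of the tuple `μ` w.r.t. `m`. -/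
def IsDensityVec {X : Type*} [MeasurableSpace X] {d : ℕ}
    (μ : Fin d → Measure X) (m : Measure X) (g : X → Fin d → ℝ) : Prop :=
  Measurable g ∧ ∀ j, μ j = m.withDensity (fun x => ENNReal.ofReal (g x j))

/-- `K` is a disintegration of `m` along the map `g` with mixing measure `P = m ∘ g⁻¹`. -/
def IsDisintegration {X : Type*} [MeasurableSpace X] {d : ℕ}
    (P : Measure (Fin d → ℝ)) (g : X → Fin d → ℝ) (m : Measure X)
    (K : Kernel (Fin d → ℝ) X) : Prop :=
  IsMarkovKernel K ∧ (∀ᵐ z ∂P, K z (g ⁻¹' {z}) = 1) ∧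
    m = P.bind (fun z => K z)

/-- Topological support of a measure. -/
def measSupport {X : Type*} [TopologicalSpace X] [MeasurableSpace X]
    (m : Measure X) : Set X :=
  {x | ∀ U : Set X, IsOpen U → x ∈ U → m U ≠ 0}

section

open scoped unitInterval CompactlySupported

lemma aux_measure_le {Z : Type*} [TopologicalSpace Z] [CompactSpace Z]
    [TopologicalSpace.MetrizableSpace Z] [MeasurableSpace Z] [BorelSpace Z]
    (a b : Measure Z) [IsFiniteMeasure a] [IsFiniteMeasure b]
    (h : ∀ ψ : C(Z, ℝ), (∀ y, 0 ≤ ψ y) → ∫ y, ψ y ∂a ≤ ∫ y, ψ y ∂b) : a ≤ b := by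
  let _ := TopologicalSpace.metrizableSpaceMetric Z
  have hF : ∀ F : Set Z, IsClosed F → a F ≤ b F := by
    intro F hF
    refine le_of_tendsto_of_tendsto' (HasOuterApproxClosed.tendsto_lintegral_apprSeq hF a)
      (HasOuterApproxClosed.tendsto_lintegral_apprSeq hF b) (fun n => ?_)
    have h1 := h ⟨fun y => (hF.apprSeq n y : ℝ), by fun_prop⟩ (fun y => by simp)
    simp only [ContinuousMap.coe_mk] at h1
    rw [← BoundedContinuousFunction.toReal_lintegral_coe_eq_integral,
      ← BoundedContinuousFunction.toReal_lintegral_coe_eq_integral] at h1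
    exact (ENNReal.toReal_le_toReal (BoundedContinuousFunction.lintegral_lt_top_of_nnreal a _).ne
      (BoundedContinuousFunction.lintegral_lt_top_of_nnreal b _).ne).1 h1
  refine Measure.le_iff.2 fun s hs => ?_
  rw [hs.measure_eq_iSup_isClosed_of_ne_top (measure_ne_top a s)]
  refine iSup_le fun F => iSup_le fun hFs => iSup_le fun hFc => (hF F hFc).trans (measure_mono hFs)

abbrev KK (d : ℕ) := Fin d → I

lemma core {d : ℕ} (P : Measure (KK d)) [IsFiniteMeasure P] (n : Fin d → Measure I)
    [∀ j, IsFiniteMeasure (n j)]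
    (H : ∀ (u : C(KK d, ℝ)) (ψ : Fin d → C(I, ℝ)), (∀ j y, 0 ≤ ψ j y) →
      (∀ z y, ∑ j, (z j : ℝ) * ψ j y ≤ u z) → ∑ j, ∫ y, ψ j y ∂(n j) ≤ ∫ z, u z ∂P) :
    ∃ κ : Kernel (KK d) I, IsMarkovKernel κ ∧ ∀ j B, MeasurableSet B →
      n j B ≤ ∫⁻ z, ENNReal.ofReal (z j) * κ z B ∂P := by
  let E := C(KK d × I, ℝ) × (Fin d → C(I, ℝ))
  have intK : ∀ (u : C(KK d, ℝ)), Integrable u P := fun u =>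
    (BoundedContinuousFunction.mkOfCompact u).integrable P
  have intI : ∀ j (u : C(I, ℝ)), Integrable u (n j) := fun j u =>
    (BoundedContinuousFunction.mkOfCompact u).integrable (n j)
  let sec : C(KK d, KK d × I) := ⟨fun z => (z, 0), by fun_prop⟩
  let l : E →ₗ[ℝ] ℝ :=
    { toFun := fun w => ∫ z, w.1.comp sec z ∂P - ∑ j, ∫ y, w.2 j y ∂(n j)
      map_add' := by
        intro a b
        have h1 : ∫ z, (a + b).1.comp sec z ∂P
            = ∫ z, a.1.comp sec z ∂P + ∫ z, b.1.comp sec z ∂P :=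
          integral_add (intK (a.1.comp sec)) (intK (b.1.comp sec))
        have h2 : ∀ j, ∫ y, (a + b).2 j y ∂(n j) = ∫ y, a.2 j y ∂(n j) + ∫ y, b.2 j y ∂(n j) :=
          fun j => integral_add (intI j _) (intI j _)
        rw [h1]
        simp_rw [h2, Finset.sum_add_distrib]
        ring
      map_smul' := by
        intro c a
        have h1 : ∫ z, (c • a).1.comp sec z ∂P = c * ∫ z, a.1.comp sec z ∂P :=
          integral_const_mul c _
        have h2 : ∀ j, ∫ y, (c • a).2 j y ∂(n j) = c * ∫ y, a.2 j y ∂(n j) :=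
          fun j => integral_const_mul c _
        rw [h1]
        simp_rw [h2, ← Finset.mul_sum]
        simp only [RingHom.id_apply, smul_eq_mul]
        ring }
  let D : Submodule ℝ E :=
    { carrier := {w | ∀ z y, w.1 (z, y) = w.1 (z, 0)}
      add_mem' := by
        intro a b ha hb z y
        change a.1 (z, y) + b.1 (z, y) = a.1 (z, 0) + b.1 (z, 0)
        rw [ha z y, hb z y]
      zero_mem' := fun z y => rfl
      smul_mem' := by
        intro c a ha z y
        change c * a.1 (z, y) = c * a.1 (z, 0)
        rw [ha z y] }
  let s : PointedCone ℝ E :=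
    { carrier := {w | (∀ j y, 0 ≤ w.2 j y) ∧
        ∀ z y, ∑ j, (z j : ℝ) * w.2 j y ≤ w.1 (z, y)}
      add_mem' := by
        intro a b ha hb
        refine ⟨fun j y => add_nonneg (ha.1 j y) (hb.1 j y), fun z y => ?_⟩
        change ∑ j, (z j : ℝ) * (a.2 j y + b.2 j y) ≤ a.1 (z, y) + b.1 (z, y)
        simp_rw [mul_add, Finset.sum_add_distrib]
        exact add_le_add (ha.2 z y) (hb.2 z y)
      zero_mem' := by
        refine ⟨fun j y => le_rfl, fun z y => ?_⟩
        change ∑ j, (z j : ℝ) * (0 : ℝ) ≤ 0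
        simp
      smul_mem' := by
        intro c a ha
        refine ⟨fun j y => mul_nonneg c.2 (ha.1 j y), fun z y => ?_⟩
        change ∑ j, (z j : ℝ) * ((c : ℝ) * a.2 j y) ≤ (c : ℝ) * a.1 (z, y)
        have : ∑ j, (z j : ℝ) * ((c : ℝ) * a.2 j y) = c * ∑ j, (z j : ℝ) * a.2 j y := by
          rw [Finset.mul_sum]; exact Finset.sum_congr rfl fun j _ => by ring
        rw [this]
        exact mul_le_mul_of_nonneg_left (ha.2 z y) c.2 }
  obtain ⟨Φ, hΦ1, hΦ2⟩ := riesz_extension s (l.toPMap D)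
    (by
      rintro ⟨w, hw⟩ hws
      change 0 ≤ ∫ z, w.1.comp sec z ∂P - ∑ j, ∫ y, w.2 j y ∂(n j)
      rw [sub_nonneg]
      refine H (w.1.comp sec) w.2 hws.1 fun z y => ?_
      refine (hws.2 z y).trans (hw z y).le)
    (by
      rintro ⟨w, ψ⟩
      refine ⟨⟨(ContinuousMap.const _ (‖w‖ + ∑ j, 2 * ‖ψ j‖), fun j => ContinuousMap.const _ ‖ψ j‖),
        fun z y => rfl⟩, fun j y => ?_, fun z y => ?_⟩
      · change 0 ≤ ‖ψ j‖ + ψ j y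
        have := (abs_le.1 ((ψ j).norm_coe_le_norm y)).1
        linarith
      · change ∑ j, (z j : ℝ) * (‖ψ j‖ + ψ j y) ≤ (‖w‖ + ∑ j, 2 * ‖ψ j‖) + w (z, y)
        have h1 := (abs_le.1 (w.norm_coe_le_norm (z, y))).1
        have h2 : ∑ j, (z j : ℝ) * (‖ψ j‖ + ψ j y) ≤ ∑ j, 2 * ‖ψ j‖ := by
          refine Finset.sum_le_sum fun j _ => ?_
          have := (abs_le.1 ((ψ j).norm_coe_le_norm y))
          have h3 := (z j).2.1
          have h4 := (z j).2.2
          nlinarith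
        linarith)
  have hΦ3 : ∀ w : E, (∀ z y, w.1 (z, y) = w.1 (z, 0)) → Φ w = l w := fun w hw => hΦ1 ⟨w, hw⟩
  let toE : C_c(KK d × I, ℝ) →ₗ[ℝ] E :=
    { toFun := fun w => (w.toContinuousMap, 0)
      map_add' := fun a b => Prod.ext rfl (zero_add _).symm
      map_smul' := fun a b => Prod.ext rfl (smul_zero _).symm }
  let Λ : C_c(KK d × I, ℝ) →ₚ[ℝ] ℝ := PositiveLinearMap.mk₀ (Φ.comp toE) (by
    intro w hw
    refine hΦ2 _ ⟨fun j y => le_rfl, fun z y => ?_⟩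
    have : 0 ≤ w (z, y) := hw (z, y)
    change ∑ j, (z j : ℝ) * (0 : ℝ) ≤ w (z, y)
    simpa using this)
  let π := RealRMK.rieszMeasure Λ
  have hπfin : IsFiniteMeasure π := inferInstance
  have hπ : ∀ w : C(KK d × I, ℝ), ∫ p, w p ∂π = Φ (w, 0) := fun w =>
    RealRMK.integral_rieszMeasure Λ (CompactlySupportedContinuousMap.continuousMapEquiv w)
  have hfst : π.fst = P := by
    refine ext_of_forall_integral_eq_of_IsFiniteMeasure fun f => ?_
    have e1 : ∫ z, f z ∂π.fst = ∫ p, f p.1 ∂π := by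
      rw [Measure.fst, integral_map measurable_fst.aemeasurable
        f.continuous.measurable.aestronglyMeasurable]
    rw [e1]
    have e2 := hπ ⟨fun p => f p.1, by fun_prop⟩
    refine e2.trans ((hΦ3 (⟨fun p => f p.1, by fun_prop⟩, 0) (fun z y => rfl)).trans ?_)
    change ∫ z, f z ∂P - ∑ j, ∫ y, (0 : ℝ) ∂(n j) = _
    simp
  have hge : ∀ j (ψ : C(I, ℝ)), (∀ y, 0 ≤ ψ y) →
      ∫ y, ψ y ∂(n j) ≤ ∫ p, (p.1 j : ℝ) * ψ p.2 ∂π := by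
    intro j ψ hψ
    have e2 := hπ ⟨fun p => (p.1 j : ℝ) * ψ p.2, by fun_prop⟩
    simp only [ContinuousMap.coe_mk] at e2
    rw [e2]
    have e3 := hΦ3 (0, Pi.single j ψ) (fun z y => rfl)
    have e4 : l (0, Pi.single j ψ) = - ∫ y, ψ y ∂(n j) := by
      change ∫ z, (0 : ℝ) ∂P - ∑ i, ∫ y, (Pi.single j ψ : Fin d → C(I, ℝ)) i y ∂(n i) = _
      rw [Finset.sum_eq_single j]
      · simp
      · intro i _ hi
        simp [Pi.single_eq_of_ne hi]
      · simp
    have e5 := hΦ2 ((⟨fun p => (p.1 j : ℝ) * ψ p.2, by fun_prop⟩, 0) + (0, Pi.single j ψ)) (by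
      refine ⟨fun i y => ?_, fun z y => ?_⟩
      · change 0 ≤ (0 : ℝ) + (Pi.single j ψ : Fin d → C(I, ℝ)) i y
        rw [zero_add]
        by_cases hi : i = j
        · subst hi; simpa using hψ y
        · simp [Pi.single_eq_of_ne hi]
      · change ∑ i, (z i : ℝ) * ((0 : ℝ) + (Pi.single j ψ : Fin d → C(I, ℝ)) i y)
          ≤ (z j : ℝ) * ψ y + 0
        rw [Finset.sum_eq_single j]
        · simp
        · intro i _ hi
          simp [Pi.single_eq_of_ne hi]
        · simp)
    rw [map_add] at e5
    rw [e3, e4] at e5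
    linarith
  refine ⟨π.condKernel, inferInstance, fun j B hB => ?_⟩
  have mj : Measurable fun p : KK d × I => ENNReal.ofReal (p.1 j : ℝ) := by fun_prop
  let m : Measure I := (π.withDensity (fun p => ENNReal.ofReal (p.1 j))).snd
  have : IsFiniteMeasure (π.withDensity (fun p => ENNReal.ofReal (p.1 j : ℝ))) := by
    refine isFiniteMeasure_withDensity_ofReal ?_
    exact (BoundedContinuousFunction.mkOfCompact
      (⟨fun p : KK d × I => (p.1 j : ℝ), by fun_prop⟩ : C(KK d × I, ℝ))).integrable π |>.2
  have hm : n j ≤ m := by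
    refine aux_measure_le _ _ fun ψ hψ => ?_
    refine (hge j ψ hψ).trans (le_of_eq ?_)
    change _ = ∫ y, ψ y ∂((π.withDensity (fun p => ENNReal.ofReal (p.1 j))).map Prod.snd)
    rw [integral_map measurable_snd.aemeasurable
        ψ.continuous.measurable.aestronglyMeasurable,
        integral_withDensity_eq_integral_toReal_smul mj (by simp)]
    refine integral_congr_ae (Filter.Eventually.of_forall fun p => ?_)
    simp [ENNReal.toReal_ofReal (p.1 j).2.1]
  refine (hm B).trans (le_of_eq ?_)
  rw [Measure.snd_apply hB, withDensity_apply _ (measurable_snd hB)]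
  conv_lhs => rw [← π.disintegrate π.condKernel, hfst]
  rw [← lintegral_indicator (measurable_snd hB), Measure.lintegral_compProd
    (mj.indicator (measurable_snd hB))]
  refine lintegral_congr fun z => ?_
  have : ∀ y, (Prod.snd ⁻¹' B).indicator (fun p : KK d × I => ENNReal.ofReal (p.1 j : ℝ)) (z, y)
      = ENNReal.ofReal (z j) * B.indicator 1 y := by
    intro y
    by_cases hy : y ∈ B <;> simp [Set.indicator, hy]
  simp_rw [this]
  rw [lintegral_const_mul _ (measurable_one.indicator hB), lintegral_indicator_one hB]



lemma aux_cdf_map (q : Measure ℝ) [IsProbabilityMeasure q] (hq : ∀ r, q {r} = 0) :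
    ∃ c : ℝ → I, Measurable c ∧ q.map c = volume := by
  have hcont : Continuous (cdf q) := by
    rw [continuous_iff_continuousAt]
    intro x
    rw [(monotone_cdf q).continuousAt_iff_leftLim_eq_rightLim]
    have h1 := hq x
    rw [← measure_cdf q, StieltjesFunction.measure_singleton, ENNReal.ofReal_eq_zero] at h1
    have h2 := (monotone_cdf q).leftLim_le (le_refl x)
    rw [StieltjesFunction.rightLim_eq]
    linarith
  let c : ℝ → I := fun t => ⟨cdf q t, cdf_nonneg q t, cdf_le_one q t⟩
  have hc : Measurable c := (monotone_cdf q).measurable.subtype_mk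
  have surj : ∀ a : ℝ, 0 < a → a < 1 → ∃ t, cdf q t = a := by
    intro a h0 h1
    refine mem_range_of_exists_le_of_exists_ge hcont ?_ ?_
    · exact ((tendsto_cdf_atBot q).eventually (gt_mem_nhds h0)).exists.imp fun _ h => h.le
    · exact ((tendsto_cdf_atTop q).eventually (lt_mem_nhds h1)).exists.imp fun _ h => h.le
  refine ⟨c, hc, ?_⟩
  have : IsProbabilityMeasure (q.map c) := Measure.isProbabilityMeasure_map hc.aemeasurable
  refine Measure.ext_of_Iic _ _ fun a => ?_
  rw [unitInterval.volume_Iic, Measure.map_apply hc measurableSet_Iic]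
  have hset : c ⁻¹' Set.Iic a = {t | cdf q t ≤ a} := rfl
  rw [hset]
  obtain ⟨a, ha0, ha1⟩ := a
  simp only
  rcases ha1.eq_or_lt with rfl | ha1
  · simp [cdf_le_one]
  refine le_antisymm ?_ ?_
  · have key : ∀ b : ℝ, a < b → b < 1 → q.real {t | cdf q t ≤ a} ≤ b := by
      intro b hab hb
      obtain ⟨t, ht⟩ := surj b (by linarith) hb
      rw [← ht, cdf_eq_real]
      refine measureReal_mono fun r hr => ?_
      by_contra hrt
      have := monotone_cdf q (not_le.1 hrt).le
      have hr' : cdf q r ≤ a := hr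
      linarith
    rw [← ofReal_measureReal]
    refine ENNReal.ofReal_le_ofReal ?_
    refine le_of_forall_gt_imp_ge_of_dense fun b hb => ?_
    by_cases h : b < 1
    · exact key b hb h
    · exact measureReal_le_one.trans (not_lt.1 h)
  · rcases ha0.eq_or_lt with rfl | ha0
    · simp
    obtain ⟨t, ht⟩ := surj a ha0 ha1
    rw [← ht, ofReal_cdf]
    exact measure_mono fun r hr => monotone_cdf q hr

def NN {d : ℕ} (v : Fin d → ℝ) : KK d := fun j =>
  ⟨max (v j) 0 / ∑ i, max (v i) 0, by
    have h0 : ∀ i, 0 ≤ max (v i) 0 := fun i => le_max_right _ _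
    refine ⟨div_nonneg (h0 j) (Finset.sum_nonneg fun i _ => h0 i), ?_⟩
    exact div_le_one_of_le₀ (Finset.single_le_sum (fun i _ => h0 i) (Finset.mem_univ j))
      (Finset.sum_nonneg fun i _ => h0 i)⟩

lemma NN_measurable {d : ℕ} : Measurable (NN : (Fin d → ℝ) → KK d) := by
  refine measurable_pi_lambda _ fun j => Measurable.subtype_mk ?_
  fun_prop

lemma NN_spec {d : ℕ} (v : Fin d → ℝ) (j : Fin d) :
    (∑ i, max (v i) 0) * (NN v j : ℝ) = max (v j) 0 := by
  have h0 : ∀ i, 0 ≤ max (v i) 0 := fun i => le_max_right _ _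
  change (∑ i, max (v i) 0) * (max (v j) 0 / ∑ i, max (v i) 0) = _
  by_cases h : ∑ i, max (v i) 0 = 0
  · have := (Finset.sum_eq_zero_iff_of_nonneg (fun i _ => h0 i)).1 h j (Finset.mem_univ j)
    rw [h, this]; simp
  · field_simp

lemma ofReal_maxz (a : ℝ) : ENNReal.ofReal (max a 0) = ENNReal.ofReal a := by
  simp [ENNReal.ofReal_max]

lemma sum_eq_withDensity {X : Type*} [MeasurableSpace X] {d : ℕ} (μ : Fin d → Measure X)
    (lam : Measure X) (g : X → Fin d → ℝ) (hg : Measurable g)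
    (hμ : ∀ j, μ j = lam.withDensity (fun x => ENNReal.ofReal (g x j))) :
    ∑ j, μ j = lam.withDensity (fun x => ENNReal.ofReal (∑ i, max (g x i) 0)) := by
  ext B hB
  rw [withDensity_apply _ hB, Measure.finsetSum_apply]
  simp_rw [ENNReal.ofReal_sum_of_nonneg (fun i _ => le_max_right _ _), ofReal_maxz]
  rw [lintegral_finsetSum _ (fun i _ => by fun_prop)]
  refine Finset.sum_congr rfl fun j _ => ?_
  rw [hμ j, withDensity_apply _ hB]

lemma eq_withDensity_NN {X : Type*} [MeasurableSpace X] {d : ℕ} (μ : Fin d → Measure X)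
    (lam : Measure X) (g : X → Fin d → ℝ) (hg : Measurable g)
    (hμ : ∀ j, μ j = lam.withDensity (fun x => ENNReal.ofReal (g x j))) (j : Fin d) :
    μ j = (∑ i, μ i).withDensity (fun x => ENNReal.ofReal (NN (g x) j)) := by
  have hm : Measurable fun x => ENNReal.ofReal (NN (g x) j : ℝ) := by
    have := (measurable_pi_apply j).comp (NN_measurable.comp hg)
    exact (measurable_subtype_coe.comp this).ennreal_ofReal
  rw [sum_eq_withDensity μ lam g hg hμ, ← withDensity_mul _ (by fun_prop) hm, hμ j]
  congr 1
  ext x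
  rw [Pi.mul_apply, ← ENNReal.ofReal_mul (Finset.sum_nonneg fun i _ => le_max_right _ _), NN_spec,
    ofReal_maxz]

lemma integrable_pos {X : Type*} [MeasurableSpace X] (m lam : Measure X) [IsFiniteMeasure m]
    (φ : X → ℝ) (hφ : Measurable φ) (h : m = lam.withDensity (fun x => ENNReal.ofReal (φ x))) :
    Integrable (fun x => max (φ x) 0) lam := by
  refine ⟨by fun_prop, ?_⟩
  have h0 : 0 ≤ᵐ[lam] fun x => max (φ x) 0 := Filter.Eventually.of_forall fun x => le_max_right _ _
  rw [hasFiniteIntegral_iff_ofReal h0]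
  simp_rw [ofReal_maxz]
  have := measure_lt_top m Set.univ
  rwa [h, withDensity_apply _ MeasurableSet.univ, Measure.restrict_univ] at this

lemma step2 {X Y : Type*} [MeasurableSpace X] [MeasurableSpace Y] [StandardBorelSpace Y]
    [Nonempty Y] {d : ℕ} (μ : Fin d → Measure X)
    (lam : Measure X) [IsProbabilityMeasure lam] (g : X → Fin d → ℝ) (ξ : X → ℝ)
    (hg : Measurable g) (hξ : Measurable ξ)
    (hμ : ∀ j, μ j = lam.withDensity (fun x => ENNReal.ofReal (g x j)))
    (hat : ∀ r : ℝ, lam (ξ ⁻¹' {r}) = 0) (hind : IndepFun ξ g lam)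
    (κ : Kernel (KK d) Y) [IsMarkovKernel κ] :
    ∃ T : X → Y, Measurable T ∧ ∀ j B, MeasurableSet B →
      (μ j).map T B = ∫⁻ x, κ (NN (g x)) B ∂(μ j) := by
  have : IsProbabilityMeasure (lam.map ξ) := Measure.isProbabilityMeasure_map hξ.aemeasurable
  obtain ⟨c, hc, hcv⟩ := aux_cdf_map (lam.map ξ) (fun r => by
    rw [Measure.map_apply hξ (measurableSet_singleton r)]; exact hat r)
  obtain ⟨f, hf, hfκ⟩ := Kernel.exists_measurable_map_eq_unitInterval κ
  have hN := NN_measurable (d := d)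
  have hF : Measurable fun p : ℝ × (Fin d → ℝ) => f (NN p.2) (c p.1) :=
    hf.comp ((hN.comp measurable_snd).prodMk (hc.comp measurable_fst))
  have hT : Measurable fun x => f (NN (g x)) (c (ξ x)) := hF.comp (hξ.prodMk hg)
  refine ⟨fun x => f (NN (g x)) (c (ξ x)), hT, fun j B hB => ?_⟩
  have hκB : Measurable fun v : Fin d → ℝ => κ (NN v) B := (κ.measurable_coe hB).comp hN
  have hκg : Measurable fun x => κ (NN (g x)) B := hκB.comp hg
  have hgj : Measurable fun x => ENNReal.ofReal (g x j) := by fun_prop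
  rw [Measure.map_apply hT hB, hμ j, withDensity_apply _ (hT hB),
    lintegral_withDensity_eq_lintegral_mul _ hgj hκg]
  have hG : Measurable fun p : ℝ × (Fin d → ℝ) =>
      ENNReal.ofReal (p.2 j) * B.indicator (1 : Y → ℝ≥0∞) (f (NN p.2) (c p.1)) := by
    refine Measurable.mul (by fun_prop) ((measurable_one.indicator hB).comp hF)
  have e1 : ∫⁻ x in (fun x => f (NN (g x)) (c (ξ x))) ⁻¹' B, ENNReal.ofReal (g x j) ∂lam
      = ∫⁻ p, ENNReal.ofReal (p.2 j) * B.indicator (1 : Y → ℝ≥0∞) (f (NN p.2) (c p.1))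
        ∂(lam.map fun x => (ξ x, g x)) := by
    rw [lintegral_map hG (hξ.prodMk hg), ← lintegral_indicator (hT hB)]
    refine lintegral_congr fun x => ?_
    by_cases hx : f (NN (g x)) (c (ξ x)) ∈ B <;> simp [Set.indicator, hx]
  rw [e1, (indepFun_iff_map_prod_eq_prod_map_map hξ.aemeasurable hg.aemeasurable).1 hind,
    lintegral_prod_symm _ hG.aemeasurable, lintegral_map hG.lintegral_prod_left' hg]
  refine lintegral_congr fun x => ?_
  have hfx : Measurable (f (NN (g x))) := hf.of_uncurry_left
  simp only [Pi.mul_apply]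
  have hi : Measurable fun t => B.indicator (1 : Y → ℝ≥0∞) (f (NN (g x)) (c t)) :=
    (measurable_one.indicator hB).comp (hfx.comp hc)
  rw [lintegral_const_mul _ hi]
  congr 1
  rw [← hfκ, ← hcv, Measure.map_map hfx hc, Measure.map_apply (hfx.comp hc) hB,
    ← lintegral_indicator_one ((hfx.comp hc) hB)]
  rfl


lemma step1 {X Y : Type*} [MeasurableSpace X] [MeasurableSpace Y] [StandardBorelSpace Y]
    {d : ℕ} (μ : Fin d → Measure X) (ν : Fin d → Measure Y)
    [∀ j, IsFiniteMeasure (μ j)] [∀ j, IsFiniteMeasure (ν j)]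
    (lam : Measure X) (rho : Measure Y) [IsProbabilityMeasure lam] [IsProbabilityMeasure rho]
    (g : X → Fin d → ℝ) (h : Y → Fin d → ℝ) (hg : Measurable g) (hh : Measurable h)
    (hμ : ∀ j, μ j = lam.withDensity (fun x => ENNReal.ofReal (g x j)))
    (hν : ∀ j, ν j = rho.withDensity (fun y => ENNReal.ofReal (h y j)))
    (hf : ∀ f : (Fin d → ℝ) → ℝ, ConvexOn ℝ Set.univ f → Monotone f →
      Integrable (fun x => f (g x)) lam → Integrable (fun y => f (h y)) rho →
      ∫ y, f (h y) ∂rho ≤ ∫ x, f (g x) ∂lam) :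
    ∃ κ : Kernel (KK d) Y, IsMarkovKernel κ ∧ ∀ j B, MeasurableSet B →
      ν j B ≤ ∫⁻ x, κ (NN (g x)) B ∂(μ j) := by
  have : Nonempty Y := nonempty_of_isProbabilityMeasure rho
  let e := unitInterval.sigmoid ∘ embeddingReal Y
  have he : MeasurableEmbedding e := measurableEmbedding_sigmoid_comp_embeddingReal Y
  have hNg : Measurable fun x => NN (g x) := NN_measurable.comp hg
  let S : Measure X := ∑ j, μ j
  have hS : S = lam.withDensity (fun x => ENNReal.ofReal (∑ i, max (g x i) 0)) :=
    sum_eq_withDensity μ lam g hg hμ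
  let P : Measure (KK d) := S.map (fun x => NN (g x))
  have hgint : ∀ j, Integrable (fun x => max (g x j) 0) lam := fun j =>
    integrable_pos (μ j) lam (fun x => g x j) (by fun_prop) (hμ j)
  have hhint : ∀ j, Integrable (fun y => max (h y j) 0) rho := fun j =>
    integrable_pos (ν j) rho (fun x => h x j) (by fun_prop) (hν j)
  obtain ⟨κ, hκ, hκ2⟩ := core P (fun j => (ν j).map e) (by
    intro u ψ hψ hu
    let F : (Fin d → ℝ) → ℝ := fun v => ⨆ y : I, ∑ j, max (v j) 0 * ψ j y
    have hterm : ∀ (v : Fin d → ℝ) (y : I),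
        ∑ j, max (v j) 0 * ψ j y ≤ ∑ j, max (v j) 0 * ‖ψ j‖ := by
      intro v y
      refine Finset.sum_le_sum fun j _ => mul_le_mul_of_nonneg_left ?_ (le_max_right _ _)
      exact (le_abs_self _).trans ((ψ j).norm_coe_le_norm y)
    have hbdd : ∀ v : Fin d → ℝ, BddAbove (Set.range fun y : I => ∑ j, max (v j) 0 * ψ j y) :=
      fun v => ⟨_, by rintro _ ⟨y, rfl⟩; exact hterm v y⟩
    have hleF : ∀ (v : Fin d → ℝ) (y : I), ∑ j, max (v j) 0 * ψ j y ≤ F v :=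
      fun v y => le_ciSup (hbdd v) y
    have hF0 : ∀ v, 0 ≤ F v := fun v => (Finset.sum_nonneg fun j _ =>
      mul_nonneg (le_max_right _ _) (hψ j 0)).trans (hleF v 0)
    have hFle : ∀ v, F v ≤ ∑ j, max (v j) 0 * ‖ψ j‖ := fun v => ciSup_le fun y => hterm v y
    have hmono : Monotone F := by
      intro v w hvw
      refine ciSup_le fun y => le_trans ?_ (hleF w y)
      refine Finset.sum_le_sum fun j _ => mul_le_mul_of_nonneg_right ?_ (hψ j y)
      exact max_le_max (hvw j) le_rfl
    have hconv : ConvexOn ℝ Set.univ F := by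
      refine ⟨convex_univ, fun v _ w _ a b ha hb hab => ?_⟩
      refine ciSup_le fun y => ?_
      have h1 := mul_le_mul_of_nonneg_left (hleF v y) ha
      have h2 := mul_le_mul_of_nonneg_left (hleF w y) hb
      simp only [smul_eq_mul]
      refine le_trans ?_ (add_le_add h1 h2)
      rw [Finset.mul_sum, Finset.mul_sum, ← Finset.sum_add_distrib]
      refine Finset.sum_le_sum fun j _ => ?_
      have h3 : max ((a • v + b • w) j) 0 ≤ a * max (v j) 0 + b * max (w j) 0 := by
        refine max_le ?_ ?_
        · simp only [Pi.add_apply, Pi.smul_apply, smul_eq_mul]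
          exact add_le_add (mul_le_mul_of_nonneg_left (le_max_left _ _) ha)
            (mul_le_mul_of_nonneg_left (le_max_left _ _) hb)
        · exact add_nonneg (mul_nonneg ha (le_max_right _ _)) (mul_nonneg hb (le_max_right _ _))
      have h4 := mul_le_mul_of_nonneg_right h3 (hψ j y)
      linarith
    have hFcont : Continuous F := by
      rw [← continuousOn_univ]; exact hconv.continuousOn isOpen_univ
    have hFint : ∀ {A : Type _} [MeasurableSpace A] (m : Measure A) (k : A → Fin d → ℝ),
        Measurable k → (∀ j, Integrable (fun x => max (k x j) 0) m) →
        Integrable (fun x => F (k x)) m := by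
      intro A _ m k hk hki
      refine Integrable.mono' (g := fun x => ∑ j, max (k x j) 0 * ‖ψ j‖) ?_
        (hFcont.measurable.comp hk).aestronglyMeasurable
        (Filter.Eventually.of_forall fun x => ?_)
      · exact integrable_finsetSum _ fun j _ => (hki j).mul_const _
      · rw [Real.norm_of_nonneg (hF0 _)]; exact hFle _
    have hFh : Integrable (fun y => F (h y)) rho := by
      refine Integrable.mono' (g := fun x => ∑ j, max (h x j) 0 * ‖ψ j‖) ?_
        (hFcont.measurable.comp hh).aestronglyMeasurable
        (Filter.Eventually.of_forall fun x => ?_)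
      · exact integrable_finsetSum _ fun j _ => (hhint j).mul_const _
      · rw [Real.norm_of_nonneg (hF0 _)]; exact hFle _
    have hFg : Integrable (fun y => F (g y)) lam := hFint lam g hg hgint
    have hψe : ∀ j, Measurable fun y => ψ j (e y) := fun j =>
      (ψ j).continuous.measurable.comp he.measurable
    have hint1 : ∀ j, Integrable (fun y => max (h y j) 0 * ψ j (e y)) rho := fun j =>
      (hhint j).mul_bdd (c := ‖ψ j‖) (hψe j).aestronglyMeasurable
        (Filter.Eventually.of_forall fun y => (ψ j).norm_coe_le_norm _)
    have a1 : ∀ j, ∫ y, ψ j y ∂((ν j).map e) = ∫ y, max (h y j) 0 * ψ j (e y) ∂rho := by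
      intro j
      rw [he.integral_map, hν j, integral_withDensity_eq_integral_toReal_smul (by fun_prop)
        (by simp)]
      refine integral_congr_ae (Filter.Eventually.of_forall fun y => ?_)
      simp only [smul_eq_mul, ENNReal.toReal_ofReal']
    have a2 : ∑ j, ∫ y, ψ j y ∂((ν j).map e) ≤ ∫ y, F (h y) ∂rho := by
      simp_rw [a1]
      rw [← integral_finsetSum _ (fun j _ => hint1 j)]
      exact integral_mono (integrable_finsetSum _ fun j _ => hint1 j) hFh fun y => hleF _ _
    have hsum : Integrable (fun x => ∑ i, max (g x i) 0) lam := integrable_finsetSum _ fun j _ => hgint j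
    have hum : Measurable fun x => u (NN (g x)) := u.continuous.measurable.comp hNg
    have a3 : ∫ z, u z ∂P = ∫ x, (∑ i, max (g x i) 0) * u (NN (g x)) ∂lam := by
      change ∫ z, u z ∂(S.map _) = _
      rw [integral_map hNg.aemeasurable u.continuous.measurable.aestronglyMeasurable, hS,
        integral_withDensity_eq_integral_toReal_smul (by fun_prop) (by simp)]
      refine integral_congr_ae (Filter.Eventually.of_forall fun y => ?_)
      simp only [smul_eq_mul]
      rw [ENNReal.toReal_ofReal (Finset.sum_nonneg fun i _ => le_max_right _ _)]
    refine a2.trans ((hf F hconv hmono hFg hFh).trans ?_)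
    rw [a3]
    refine integral_mono hFg ?_ fun x => ciSup_le fun y => ?_
    · exact hsum.mul_bdd (c := ‖u‖) hum.aestronglyMeasurable
        (Filter.Eventually.of_forall fun y => u.norm_coe_le_norm _)
    · have h1 := mul_le_mul_of_nonneg_left (hu (NN (g x)) y)
        (Finset.sum_nonneg fun i (_ : i ∈ Finset.univ) => le_max_right (g x i) 0)
      refine le_trans (le_of_eq ?_) h1
      rw [Finset.mul_sum]
      refine Finset.sum_congr rfl fun j _ => ?_
      rw [← mul_assoc, NN_spec])
  have hr : Measurable he.invFun := by fun_prop
  refine ⟨κ.map he.invFun, Kernel.IsMarkovKernel.map κ hr, fun j B hB => ?_⟩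
  have h1 := hκ2 j _ (hr hB)
  rw [Measure.map_apply he.measurable (hr hB), ← Set.preimage_comp,
    Function.LeftInverse.id he.leftInverse_invFun, Set.preimage_id] at h1
  refine h1.trans (le_of_eq ?_)
  have hk : Measurable fun z => κ z (he.invFun ⁻¹' B) := κ.measurable_coe (hr hB)
  have hzj : Measurable fun z : KK d => ENNReal.ofReal (z j : ℝ) := by fun_prop
  change ∫⁻ z, ENNReal.ofReal (z j) * κ z (he.invFun ⁻¹' B) ∂(S.map fun x => NN (g x)) = _
  have hNj : Measurable fun x => ENNReal.ofReal (NN (g x) j : ℝ) := hzj.comp hNg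
  have hkN : Measurable fun x => κ (NN (g x)) (he.invFun ⁻¹' B) := hk.comp hNg
  have hzk : Measurable fun z : KK d => ENNReal.ofReal (z j : ℝ) * κ z (he.invFun ⁻¹' B) :=
    hzj.mul hk
  rw [lintegral_map hzk hNg, eq_withDensity_NN μ lam g hg hμ j]
  simp_rw [Kernel.map_apply' κ hr _ hB]
  rw [lintegral_withDensity_eq_lintegral_mul _ hNj hkN]
  rfl

lemma forward {X Y : Type*} [MeasurableSpace X] [MeasurableSpace Y]
    {d : ℕ} (μ : Fin d → Measure X) (ν : Fin d → Measure Y)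
    [∀ j, IsFiniteMeasure (μ j)] [∀ j, IsFiniteMeasure (ν j)]
    (lam : Measure X) [IsProbabilityMeasure lam]
    (g : X → Fin d → ℝ) (hg : Measurable g) (hg0 : ∀ x j, 0 ≤ g x j)
    (hμ : ∀ j, μ j = lam.withDensity (fun x => ENNReal.ofReal (g x j)))
    (T : X → Y) (hT : Measurable T) (hle : ∀ j, ν j ≤ (μ j).map T) :
    ∃ (rho : Measure Y) (h : Y → Fin d → ℝ), IsProbabilityMeasure rho ∧ Measurable h ∧
    (∀ j, ν j = rho.withDensity (fun y => ENNReal.ofReal (h y j))) ∧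
    ∀ f : (Fin d → ℝ) → ℝ, ConvexOn ℝ Set.univ f → Monotone f →
      Integrable (fun x => f (g x)) lam → Integrable (fun y => f (h y)) rho →
      ∫ y, f (h y) ∂rho ≤ ∫ x, f (g x) ∂lam := by
  have hgint : ∀ j, Integrable (fun x => g x j) lam := fun j => by
    have := integrable_pos (μ j) lam (fun x => g x j) (by fun_prop) (hμ j)
    refine this.congr (Filter.Eventually.of_forall fun x => ?_)
    simp [hg0 x j]
  let rho := lam.map T
  have hrho : IsProbabilityMeasure rho := Measure.isProbabilityMeasure_map hT.aemeasurable
  let k := condDistrib g T lam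
  have hk : rho ⊗ₘ k = lam.map (fun x => (T x, g x)) := compProd_map_condDistrib hg.aemeasurable
  have hTg : Measurable fun x => (T x, g x) := hT.prodMk hg
  have hz : ∀ j, Measurable fun p : Y × (Fin d → ℝ) => ENNReal.ofReal (p.2 j) := fun j => by fun_prop
  have hA : ∀ j, Measurable fun y => ∫⁻ z, ENNReal.ofReal (z j) ∂(k y) := fun j =>
    (by fun_prop : Measurable fun z : Fin d → ℝ => ENNReal.ofReal (z j)).lintegral_kernel
  have hmap : ∀ j, (μ j).map T = rho.withDensity fun y => ∫⁻ z, ENNReal.ofReal (z j) ∂(k y) := by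
    intro j
    ext B hB
    rw [Measure.map_apply hT hB, hμ j, withDensity_apply _ (hT hB), withDensity_apply _ hB]
    have e1 : ∫⁻ x in T ⁻¹' B, ENNReal.ofReal (g x j) ∂lam
        = ∫⁻ p in B ×ˢ Set.univ, ENNReal.ofReal (p.2 j) ∂(lam.map (fun x => (T x, g x))) := by
      rw [setLIntegral_map (hB.prod MeasurableSet.univ) (hz j) hTg]
      congr 2
      ext x; simp
    rw [e1, ← hk, Measure.setLIntegral_compProd (hz j) hB MeasurableSet.univ]
    simp
  have hac : ∀ j, ν j ≪ rho := fun j =>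
    (Measure.absolutelyContinuous_of_le (hle j)).trans (by
      rw [hmap j]; exact withDensity_absolutelyContinuous _ _)
  have hrn : ∀ j, ν j = rho.withDensity (fun y => ENNReal.ofReal ((ν j).rnDeriv rho y).toReal) := by
    intro j
    conv_lhs => rw [← Measure.withDensity_rnDeriv_eq _ _ (hac j)]
    refine withDensity_congr_ae ?_
    filter_upwards [(ν j).rnDeriv_lt_top rho] with y hy
    rw [ENNReal.ofReal_toReal hy.ne]
  refine ⟨rho, fun y j => ((ν j).rnDeriv rho y).toReal, hrho, ?_, hrn, ?_⟩
  · exact measurable_pi_lambda _ fun j => (Measure.measurable_rnDeriv _ _).ennreal_toReal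
  intro f hfc hfm hfg hfh
  have hfcont : Continuous f := by
    rw [← continuousOn_univ]; exact hfc.continuousOn isOpen_univ
  have hfi : Integrable (fun p : Y × (Fin d → ℝ) => f p.2) (rho ⊗ₘ k) := by
    rw [hk, integrable_map_measure (by fun_prop) hTg.aemeasurable]
    exact hfg
  have hzi : ∀ j, Integrable (fun p : Y × (Fin d → ℝ) => p.2 j) (rho ⊗ₘ k) := fun j => by
    rw [hk, integrable_map_measure (by fun_prop) hTg.aemeasurable]
    exact hgint j
  have hpos : ∀ᵐ y ∂rho, ∀ᵐ z ∂(k y), ∀ j, 0 ≤ z j := by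
    have : ∀ᵐ p ∂(rho ⊗ₘ k), ∀ j, 0 ≤ p.2 j := by
      rw [hk, ae_map_iff hTg.aemeasurable]
      · exact Filter.Eventually.of_forall hg0
      · rw [Set.ofPred_forall]
        exact MeasurableSet.iInter fun j => measurableSet_le measurable_const (by fun_prop)
    exact Measure.ae_ae_of_ae_compProd this
  have e2 : ∫ x, f (g x) ∂lam = ∫ y, ∫ z, f z ∂(k y) ∂rho := by
    rw [← Measure.integral_compProd hfi, hk, integral_map hTg.aemeasurable (by fun_prop)]
  rw [e2]
  have hrnle : ∀ᵐ y ∂rho, ∀ j, (ν j).rnDeriv rho y ≤ ∫⁻ z, ENNReal.ofReal (z j) ∂(k y) := by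
    rw [ae_all_iff]
    intro j
    refine ae_le_of_forall_setLIntegral_le_of_sigmaFinite (Measure.measurable_rnDeriv _ _) ?_
    intro B hB _
    rw [← withDensity_apply _ hB, ← withDensity_apply _ hB,
      Measure.withDensity_rnDeriv_eq _ _ (hac j), ← hmap j]
    exact hle j B
  have hzi' : ∀ᵐ y ∂rho, ∀ j, Integrable (fun z : Fin d → ℝ => z j) (k y) := by
    rw [ae_all_iff]
    intro j
    exact ((Measure.integrable_compProd_iff (hzi j).1).1 (hzi j)).1
  have hfi' : ∀ᵐ y ∂rho, Integrable f (k y) :=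
    ((Measure.integrable_compProd_iff hfi.1).1 hfi).1
  have hint : Integrable (fun y => ∫ z, f z ∂(k y)) rho := by
    have h0 := ((Measure.integrable_compProd_iff hfi.1).1 hfi).2
    refine h0.mono' ?_ (Filter.Eventually.of_forall fun y => norm_integral_le_integral_norm _)
    exact (hfcont.stronglyMeasurable.comp_measurable measurable_snd
      |>.integral_kernel_prod_right' (κ := k)).aestronglyMeasurable
  refine integral_mono_ae hfh hint ?_
  filter_upwards [hrnle, hzi', hfi', hpos] with y h1 h2 h3 h4
  have hid : Integrable (fun z : Fin d → ℝ => z) (k y) := Integrable.of_eval h2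
  have hJ := hfc.map_integral_le (μ := k y) (f := fun z => z) hfcont.continuousOn isClosed_univ
    (by simp) hid h3
  refine le_trans (hfm fun j => ?_) hJ
  rw [eval_integral h2]
  have h5 : 0 ≤ᵐ[k y] fun z : Fin d → ℝ => z j := by
    filter_upwards [h4] with z hz using hz j
  rw [integral_eq_lintegral_of_nonneg_ae h5 (h2 j).1]
  refine ENNReal.toReal_mono ?_ (h1 j)
  have := (hasFiniteIntegral_iff_ofReal h5).1 (h2 j).2
  exact this.ne


end

theorem stmt1 {X Y : Type*}
    [MeasurableSpace X] [TopologicalSpace X] [PolishSpace X] [BorelSpace X]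
    [MeasurableSpace Y] [TopologicalSpace Y] [PolishSpace Y] [BorelSpace Y]
    {d : ℕ} (μ : Fin d → Measure X) (ν : Fin d → Measure Y)
    (hμfin : ∀ j, IsFiniteMeasure (μ j)) (hνfin : ∀ j, IsFiniteMeasure (ν j))
    (hμ0 : ∀ j, μ j ≠ 0) (hν0 : ∀ j, ν j ≠ 0)
    (hja : JointlyAtomless μ) :
    (∃ T : X → Y, IsSimulMap T μ ν) ↔ HeteroOrder μ ν := by
  have hX : StandardBorelSpace X := inferInstance
  obtain ⟨lam', g', ξ, hlam', hg', hξ, hμ', hat, hind⟩ := hja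
  constructor
  · rintro ⟨T, hT, hle⟩
    have hμp : ∀ j, μ j = lam'.withDensity (fun x => ENNReal.ofReal (max (g' x j) 0)) := by
      intro j
      simp_rw [ofReal_maxz]
      exact hμ' j
    have hgp : Measurable fun x j => max (g' x j) 0 := by fun_prop
    obtain ⟨rho, h, h1, h2, h3, h4⟩ := forward μ ν lam' (fun x j => max (g' x j) 0) hgp
      (fun x j => le_max_right _ _) hμp T hT hle
    exact ⟨lam', rho, _, h, hlam', h1, hgp, h2, hμp, h3, h4⟩
  · rintro ⟨lam, rho, g, h, hlam, hrho, hg, hh, hμ, hν, hf⟩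
    have : Nonempty Y := nonempty_of_isProbabilityMeasure rho
    obtain ⟨κ, hκ, hκ2⟩ := step1 μ ν lam rho g h hg hh hμ hν hf
    obtain ⟨T, hT, hT2⟩ := step2 μ lam' g' ξ hg' hξ hμ' hat hind κ
    refine ⟨T, hT, fun j => Measure.le_iff.2 fun B hB => ?_⟩
    rw [hT2 j B hB]
    refine (hκ2 j B hB).trans (le_of_eq (lintegral_congr_ae ?_))
    have hm : ∀ (k : X → Fin d → ℝ), Measurable k → ∀ i,
        Measurable fun x => ENNReal.ofReal (NN (k x) i : ℝ) := fun k hk i =>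
      (measurable_subtype_coe.comp
        ((measurable_pi_apply i).comp (NN_measurable.comp hk))).ennreal_ofReal
    have hS : ∀ i, (fun x => ENNReal.ofReal (NN (g x) i : ℝ)) =ᵐ[∑ i, μ i]
        fun x => ENNReal.ofReal (NN (g' x) i : ℝ) := by
      intro i
      refine (withDensity_eq_iff_of_sigmaFinite (hm g hg i).aemeasurable
        (hm g' hg' i).aemeasurable).1 ?_
      rw [← eq_withDensity_NN μ lam g hg hμ i, ← eq_withDensity_NN μ lam' g' hg' hμ' i]
    have hac : μ j ≪ ∑ i, μ i := by
      rw [eq_withDensity_NN μ lam g hg hμ j]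
      exact withDensity_absolutelyContinuous _ _
    have hall : ∀ᵐ x ∂(μ j), ∀ i, ENNReal.ofReal (NN (g x) i : ℝ)
        = ENNReal.ofReal (NN (g' x) i : ℝ) := by
      rw [ae_all_iff]
      exact fun i => hac.ae_le (hS i)
    filter_upwards [hall] with x hx
    have : NN (g x) = NN (g' x) := by
      funext i
      exact Subtype.ext ((ENNReal.ofReal_eq_ofReal_iff (NN (g x) i).2.1 (NN (g' x) i).2.1).1 (hx i))
    rw [this]

end
end

section
/- Let T ≥ 3 be an integer, let σ_1,…,σ_T > 0, and let μ_t := N(0,σ_t²) be the centered Gaussian Borel probability measure on ℝ with variance σ_t². If there exists a Markov kernel κ from ℝ to ℝ such that κ_#μ_t = μ_{t+1} for every t ∈ {1,…,T−1}, then the map t ↦ σ_t on {1,…,T} is either nondecreasing and log-concave (σ_t ≤ σ_{t+1} for all t ≤ T−1 and σ_{t+1}² ≥ σ_t·σ_{t+2} for all t ≤ T−2) or nonincreasing and log-convex (σ_t ≥ σ_{t+1} for all t ≤ T−1 and σ_{t+1}² ≤ σ_t·σ_{t+2} for all t ≤ T−2). Conversely, if T = 3, this condition also implies the existence of such a kernel.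 -/
open MeasureTheory ProbabilityTheory ENNReal

noncomputable section

/-- There is a Markov kernel pushing `N(0, σ_t²)` to `N(0, σ_{t+1}²)` simultaneously
for all `t ∈ {1, …, T-1}`. -/
def GaussChainExists (T : ℕ) (σ : ℕ → ℝ) : Prop :=
  ∃ κ : Kernel ℝ ℝ, IsMarkovKernel κ ∧
    ∀ t, 1 ≤ t → t + 1 ≤ T →
      (gaussianReal 0 ((σ t ^ 2).toNNReal)).bind (fun x => κ x)
        = gaussianReal 0 ((σ (t + 1) ^ 2).toNNReal)

/-- `t ↦ σ_t` is nondecreasing and log-concave on `{1, …, T}`. -/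
def IncLogConcave (T : ℕ) (σ : ℕ → ℝ) : Prop :=
  (∀ t, 1 ≤ t → t + 1 ≤ T → σ t ≤ σ (t + 1)) ∧
  (∀ t, 1 ≤ t → t + 2 ≤ T → σ t * σ (t + 2) ≤ σ (t + 1) ^ 2)

/-- `t ↦ σ_t` is nonincreasing and log-convex on `{1, …, T}`. -/
def DecLogConvex (T : ℕ) (σ : ℕ → ℝ) : Prop :=
  (∀ t, 1 ≤ t → t + 1 ≤ T → σ (t + 1) ≤ σ t) ∧
  (∀ t, 1 ≤ t → t + 2 ≤ T → σ (t + 1) ^ 2 ≤ σ t * σ (t + 2))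

lemma aux_pdf {s : ℝ} (hs : 0 < s) (x : ℝ) :
    gaussianPDFReal 0 ((s ^ 2).toNNReal) x
      = (√(2 * Real.pi))⁻¹ * (s⁻¹ * Real.exp (-x ^ 2 / (2 * s ^ 2))) := by
  rw [gaussianPDFReal, Real.coe_toNNReal _ (sq_nonneg s), Real.sqrt_mul (by positivity),
    Real.sqrt_sq hs.le, sub_zero, mul_inv, mul_assoc]

lemma aux_var_ne {s : ℝ} (hs : 0 < s) : (s ^ 2).toNNReal ≠ 0 := by
  simpa using hs.ne'

lemma aux_le {s u : ℝ} (hs : 0 < s) (hsu : s ≤ u) :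
    ENNReal.ofReal (s / u) • gaussianReal 0 ((s ^ 2).toNNReal)
      ≤ gaussianReal 0 ((u ^ 2).toNNReal) := by
  have hu : 0 < u := hs.trans_le hsu
  rw [gaussianReal_of_var_ne_zero _ (aux_var_ne hs), gaussianReal_of_var_ne_zero _ (aux_var_ne hu),
    ← withDensity_smul _ (measurable_gaussianPDF _ _)]
  refine withDensity_mono (Filter.Eventually.of_forall fun x => ?_)
  simp only [Pi.smul_apply, smul_eq_mul, gaussianPDF]
  rw [← ENNReal.ofReal_mul (by positivity), aux_pdf hs, aux_pdf hu]
  apply ENNReal.ofReal_le_ofReal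
  have h1 : s / u * ((√(2 * Real.pi))⁻¹ * (s⁻¹ * Real.exp (-x ^ 2 / (2 * s ^ 2))))
    = (√(2 * Real.pi))⁻¹ * (u⁻¹ * Real.exp (-x ^ 2 / (2 * s ^ 2))) := by
    field_simp
  rw [h1]
  have h2 : -x ^ 2 / (2 * s ^ 2) ≤ -x ^ 2 / (2 * u ^ 2) := by
    rw [neg_div, neg_div]
    apply neg_le_neg
    gcongr
  gcongr

lemma aux_ge {s u c : ℝ} (hs : 0 < s) (hu : 0 < u) (hc : 0 < c)
    (h : ENNReal.ofReal c • gaussianReal 0 ((s ^ 2).toNNReal)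
      ≤ gaussianReal 0 ((u ^ 2).toNNReal)) : s ≤ u ∧ c ≤ s / u := by
  rw [gaussianReal_of_var_ne_zero _ (aux_var_ne hs), gaussianReal_of_var_ne_zero _ (aux_var_ne hu),
    ← withDensity_smul _ (measurable_gaussianPDF _ _)] at h
  have hae : ∀ᵐ x : ℝ, c * (s⁻¹ * Real.exp (-x ^ 2 / (2 * s ^ 2)))
      ≤ u⁻¹ * Real.exp (-x ^ 2 / (2 * u ^ 2)) := by
    have h1 := ae_le_of_forall_setLIntegral_le_of_sigmaFinite (μ := (volume : Measure ℝ))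
      (f := ENNReal.ofReal c • gaussianPDF 0 ((s ^ 2).toNNReal))
      (g := gaussianPDF 0 ((u ^ 2).toNNReal))
      ((measurable_gaussianPDF _ _).const_smul _)
      (fun t ht _ => by rw [← withDensity_apply _ ht, ← withDensity_apply _ ht]; exact h t)
    filter_upwards [h1] with x hx
    simp only [Pi.smul_apply, smul_eq_mul, gaussianPDF] at hx
    rw [← ENNReal.ofReal_mul hc.le, aux_pdf hs, aux_pdf hu,
      ENNReal.ofReal_le_ofReal_iff (by positivity), mul_left_comm] at hx
    exact le_of_mul_le_mul_left hx (by positivity)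
  have hall : ∀ x : ℝ, c * (s⁻¹ * Real.exp (-x ^ 2 / (2 * s ^ 2)))
      ≤ u⁻¹ * Real.exp (-x ^ 2 / (2 * u ^ 2)) := by
    have hd := Measure.dense_of_ae hae
    have hcl : IsClosed {x : ℝ | c * (s⁻¹ * Real.exp (-x ^ 2 / (2 * s ^ 2)))
      ≤ u⁻¹ * Real.exp (-x ^ 2 / (2 * u ^ 2))} :=
      isClosed_le (by fun_prop) (by fun_prop)
    intro x
    have := hd x
    rwa [hcl.closure_eq] at this
  constructor
  · by_contra! hlt
    set d : ℝ := 1 / (2 * u ^ 2) - 1 / (2 * s ^ 2) with hd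
    have hdpos : 0 < d := by
      rw [hd, sub_pos]
      gcongr
    have hx := hall (√(s / (c * u * d)))
    have hsq : √(s / (c * u * d)) ^ 2 = s / (c * u * d) := Real.sq_sqrt (by positivity)
    rw [hsq] at hx
    set y := s / (c * u * d) with hy
    have he : Real.exp (-y / (2 * s ^ 2)) = Real.exp (-y / (2 * u ^ 2)) * Real.exp (d * y) := by
      rw [← Real.exp_add]; congr 1; rw [hd]; ring
    have hdy : d * y = s / (c * u) := by rw [hy]; field_simp
    rw [he, hdy] at hx
    have hE := Real.exp_pos (-y / (2 * u ^ 2))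
    have h3 : c * s⁻¹ * Real.exp (s / (c * u)) ≤ u⁻¹ := by
      refine le_of_mul_le_mul_right ?_ hE
      linarith
    have h4 : Real.exp (s / (c * u)) ≤ s / (c * u) := by
      rw [le_div_iff₀ (by positivity)]
      field_simp at h3
      linarith
    have := Real.add_one_le_exp (s / (c * u))
    linarith
  · have h0 := hall 0
    simp at h0
    rw [le_div_iff₀ hu]
    field_simp at h0
    linarith

lemma aux_bind_mono {κ : Kernel ℝ ℝ} {μ ν : Measure ℝ} {c : ℝ≥0∞} (h : c • μ ≤ ν) :
    c • μ.bind (fun x => κ x) ≤ ν.bind (fun x => κ x) := by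
  refine Measure.le_iff.2 fun s hs => ?_
  rw [Measure.smul_apply, Measure.bind_apply hs κ.measurable.aemeasurable,
    Measure.bind_apply hs κ.measurable.aemeasurable, smul_eq_mul, ← smul_eq_mul,
    ← lintegral_smul_measure]
  exact lintegral_mono' h le_rfl

lemma aux_step {κ : Kernel ℝ ℝ} {a b a' b' : ℝ} (ha : 0 < a) (ha' : 0 < a')
    (hb' : 0 < b') (hab : a ≤ b)
    (h1 : (gaussianReal 0 ((a ^ 2).toNNReal)).bind (fun x => κ x) = gaussianReal 0 ((a' ^ 2).toNNReal))
    (h2 : (gaussianReal 0 ((b ^ 2).toNNReal)).bind (fun x => κ x) = gaussianReal 0 ((b' ^ 2).toNNReal)) :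
    a' ≤ b' ∧ a * b' ≤ a' * b := by
  have hb : 0 < b := ha.trans_le hab
  have h := aux_bind_mono (κ := κ) (aux_le ha hab)
  rw [h1, h2] at h
  obtain ⟨h3, h4⟩ := aux_ge ha' hb' (by positivity) h
  exact ⟨h3, by rwa [div_le_div_iff₀ hb hb'] at h4⟩

lemma aux_kernel (α : ℝ) (w : NNReal) : ∃ κ : Kernel ℝ ℝ, IsMarkovKernel κ ∧
    ∀ v : NNReal, (gaussianReal 0 v).bind (fun x => κ x)
      = gaussianReal 0 (NNReal.mk (α ^ 2) (sq_nonneg _) * v + w) := by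
  have hf : Measurable (fun p : ℝ × ℝ => α * p.1 + p.2) := by fun_prop
  refine ⟨(Kernel.id ×ₖ Kernel.const ℝ (gaussianReal 0 w)).map (fun p => α * p.1 + p.2),
    Kernel.IsMarkovKernel.map _ hf, fun v => ?_⟩
  change (gaussianReal 0 v).bind ((Kernel.id ×ₖ Kernel.const ℝ (gaussianReal 0 w)).map
    (fun p => α * p.1 + p.2)) = _
  rw [← Measure.map_comp _ _ hf, ← Measure.compProd_eq_comp_prod, Measure.compProd_const]
  have h1 : (gaussianReal 0 v).map (α * ·) = gaussianReal 0 (NNReal.mk (α ^ 2) (sq_nonneg _) * v) := by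
    rw [gaussianReal_map_const_mul, mul_zero]
  have h2 := gaussianReal_conv_gaussianReal (m₁ := 0) (m₂ := 0)
    (v₁ := NNReal.mk (α ^ 2) (sq_nonneg _) * v) (v₂ := w)
  rw [add_zero, ← h1] at h2
  rw [← h2, Measure.conv]
  nth_rewrite 2 [← Measure.map_id (μ := gaussianReal 0 w)]
  rw [Measure.map_prod_map _ _ (by fun_prop) (by fun_prop),
    Measure.map_map (by fun_prop) (by fun_prop)]
  rfl

lemma aux_exists {v₁ v₂ v₃ : ℝ} (h1 : 0 < v₁) (h2 : 0 < v₂) (h3 : 0 < v₃)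
    (h : (v₁ ≤ v₂ ∧ v₂ ≤ v₃ ∧ v₁ * v₃ ≤ v₂ ^ 2) ∨ (v₂ ≤ v₁ ∧ v₃ ≤ v₂ ∧ v₂ ^ 2 ≤ v₁ * v₃)) :
    ∃ a b : ℝ, 0 ≤ a ∧ 0 ≤ b ∧ a * v₁ + b = v₂ ∧ a * v₂ + b = v₃ := by
  by_cases he : v₁ = v₂
  · subst he
    refine ⟨1, 0, by simp, by simp, by simp, ?_⟩
    rcases h with ⟨_, h, h'⟩ | ⟨_, h, h'⟩ <;> nlinarith
  · have hne : v₂ - v₁ ≠ 0 := sub_ne_zero.2 (Ne.symm he)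
    refine ⟨(v₃ - v₂) / (v₂ - v₁), (v₂ ^ 2 - v₁ * v₃) / (v₂ - v₁), ?_, ?_, ?_, ?_⟩
    · rcases h with ⟨h, h', h''⟩ | ⟨h, h', h''⟩
      · exact div_nonneg (by linarith) (by linarith)
      · exact div_nonneg_of_nonpos (by linarith) (by linarith)
    · rcases h with ⟨h, h', h''⟩ | ⟨h, h', h''⟩
      · exact div_nonneg (by linarith) (by linarith)
      · exact div_nonneg_of_nonpos (by linarith) (by linarith)
    · field_simp; ring
    · field_simp; ring

theorem stmt3 (T : ℕ) (hT : 3 ≤ T) (σ : ℕ → ℝ)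
    (hσ : ∀ t, 1 ≤ t → t ≤ T → 0 < σ t) :
    (GaussChainExists T σ → IncLogConcave T σ ∨ DecLogConvex T σ) ∧
    (T = 3 → (IncLogConcave T σ ∨ DecLogConvex T σ) → GaussChainExists T σ) := by
  constructor
  · rintro ⟨κ, -, hκ⟩
    have inc : ∀ t, 1 ≤ t → t + 2 ≤ T → σ t ≤ σ (t + 1) →
        σ (t + 1) ≤ σ (t + 2) ∧ σ t * σ (t + 2) ≤ σ (t + 1) ^ 2 := by
      intro t h1 h2 h
      have := aux_step (hσ t h1 (by omega)) (hσ (t + 1) (by omega) (by omega))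
        (hσ (t + 2) (by omega) (by omega)) h (hκ t h1 (by omega))
        (hκ (t + 1) (by omega) (by omega))
      exact ⟨this.1, by rw [sq]; exact this.2⟩
    have dec : ∀ t, 1 ≤ t → t + 2 ≤ T → σ (t + 1) ≤ σ t →
        σ (t + 2) ≤ σ (t + 1) ∧ σ (t + 1) ^ 2 ≤ σ t * σ (t + 2) := by
      intro t h1 h2 h
      have := aux_step (hσ (t + 1) (by omega) (by omega)) (hσ (t + 2) (by omega) (by omega))
        (hσ (t + 1) (by omega) (by omega)) h (hκ (t + 1) (by omega) (by omega))
        (hκ t h1 (by omega))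
      exact ⟨this.1, by rw [sq, mul_comm (σ t)]; exact this.2⟩
    rcases le_total (σ 1) (σ 2) with h | h
    · left
      have key : ∀ t, 1 ≤ t → t + 1 ≤ T → σ t ≤ σ (t + 1) := by
        intro t ht
        induction t, ht using Nat.le_induction with
        | base => exact fun _ => h
        | succ n hn ih => exact fun hT' => (inc n hn hT' (ih (by omega))).1
      exact ⟨key, fun t h1 h2 => (inc t h1 h2 (key t h1 (by omega))).2⟩
    · right
      have key : ∀ t, 1 ≤ t → t + 1 ≤ T → σ (t + 1) ≤ σ t := by
        intro t ht
        induction t, ht using Nat.le_induction with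
        | base => exact fun _ => h
        | succ n hn ih => exact fun hT' => (dec n hn hT' (ih (by omega))).1
      exact ⟨key, fun t h1 h2 => (dec t h1 h2 (key t h1 (by omega))).2⟩
  · rintro rfl h
    have p1 := hσ 1 (by omega) (by omega)
    have p2 := hσ 2 (by omega) (by omega)
    have p3 := hσ 3 (by omega) (by omega)
    have hv : (σ 1 ^ 2 ≤ σ 2 ^ 2 ∧ σ 2 ^ 2 ≤ σ 3 ^ 2 ∧ σ 1 ^ 2 * σ 3 ^ 2 ≤ (σ 2 ^ 2) ^ 2) ∨
        (σ 2 ^ 2 ≤ σ 1 ^ 2 ∧ σ 3 ^ 2 ≤ σ 2 ^ 2 ∧ (σ 2 ^ 2) ^ 2 ≤ σ 1 ^ 2 * σ 3 ^ 2) := by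
      rw [← mul_pow]
      rcases h with ⟨h, h'⟩ | ⟨h, h'⟩
      · have a1 : σ 1 ≤ σ 2 := h 1 (by omega) (by omega)
        have a2 : σ 2 ≤ σ 3 := h 2 (by omega) (by omega)
        have a3 : σ 1 * σ 3 ≤ σ 2 ^ 2 := h' 1 (by omega) (by omega)
        left
        refine ⟨by gcongr, by gcongr, by gcongr⟩
      · have a1 : σ 2 ≤ σ 1 := h 1 (by omega) (by omega)
        have a2 : σ 3 ≤ σ 2 := h 2 (by omega) (by omega)
        have a3 : σ 2 ^ 2 ≤ σ 1 * σ 3 := h' 1 (by omega) (by omega)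
        right
        refine ⟨by gcongr, by gcongr, by gcongr⟩
    obtain ⟨a, b, ha, hb, e1, e2⟩ :=
      aux_exists (by positivity) (by positivity) (by positivity) hv
    obtain ⟨κ, hκ, hk⟩ := aux_kernel (√a) b.toNNReal
    refine ⟨κ, hκ, fun t h1 h2 => ?_⟩
    rw [hk]
    congr 1
    apply NNReal.eq
    have hsq : √a ^ 2 = a := Real.sq_sqrt ha
    have ht : t = 1 ∨ t = 2 := by omega
    rcases ht with rfl | rfl
    · simp only [NNReal.coe_add, NNReal.coe_mul, NNReal.coe_mk,
        Real.coe_toNNReal _ (sq_nonneg _), Real.coe_toNNReal _ hb, hsq]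
      exact e1
    · simp only [NNReal.coe_add, NNReal.coe_mul, NNReal.coe_mk,
        Real.coe_toNNReal _ (sq_nonneg _), Real.coe_toNNReal _ hb, hsq]
      exact e2

end
end

section
/- Let X and Y be Polish spaces, let μ and ν be d-tuples of finite nonzero Borel measures on X and Y with μ_j(X) = ν_j(Y) for all j (the balanced case), let η be a Borel probability measure on X with η ≪ μ̄, and let c : X×Y → [0,+∞] be measurable such that for every x ∈ X there exists y ∈ Y with c(x,y) = 0. Then inf over κ ∈ K(μ,ν) of C_η(κ) is at least the maximum over i,j ∈ {1,…,d} of ( inf over κ ∈ K((μ_i−μ_j)_+,(ν_i−ν_j)_+) of C_η(κ) ) + ( inf over κ ∈ K((μ_j−μ_i)_+,(ν_j−ν_i)_+) of C_η(κ) ). In particular, if (μ_i−μ_j)_+(X) < (ν_i−ν_j)_+(Y) for some i,j ∈ {1,…,d}, then both sides equal +∞. -/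
open MeasureTheory ProbabilityTheory ENNReal

noncomputable section

open Set Filter Topology in
theorem capStep {X : Type*} [MeasurableSpace X] (η : Measure X) [IsFiniteMeasure η]
    (f : (ℕ → ℕ) → X) (S : Set (ℕ → ℕ)) (n : ℕ) (δ : ℝ≥0∞) (hδ : δ ≠ 0) :
    ∃ k : ℕ, η (f '' S) ≤ η (f '' (S ∩ {a | a n ≤ k})) + δ := by
  by_contra! h
  have hU : f '' S = ⋃ k : ℕ, f '' (S ∩ {a | a n ≤ k}) := by
    rw [← image_iUnion, ← inter_iUnion]
    congr 1
    ext a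
    simp only [mem_inter_iff, mem_iUnion, mem_ofPred_eq]
    exact ⟨fun h => ⟨h, a n, le_rfl⟩, fun h => h.1⟩
  have hm : Monotone fun k : ℕ => f '' (S ∩ {a | a n ≤ k}) := by
    intro k l hkl
    apply image_mono
    apply inter_subset_inter_right
    intro a ha
    exact le_trans ha hkl
  have h1 : η (f '' S) = ⨆ k : ℕ, η (f '' (S ∩ {a | a n ≤ k})) := by
    conv_lhs => rw [hU]
    exact hm.measure_iUnion
  have h2 : η (f '' S) + δ ≤ η (f '' S) := by
    conv_lhs => rw [h1]
    rw [ENNReal.iSup_add]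
    exact iSup_le fun k => (h k).le
  have h3 : η (f '' S) < η (f '' S) + δ :=
    ENNReal.lt_add_right (measure_ne_top _ _) hδ
  exact absurd h2 (not_le.2 h3)

open Set Filter Topology in
theorem boxSubset (m : ℕ → ℕ) (V : Set (ℕ → ℕ)) (hV : IsOpen V)
    (hK : (Set.univ.pi fun i => Set.Iic (m i)) ⊆ V) :
    ∃ n : ℕ, {a : ℕ → ℕ | ∀ i < n, a i ≤ m i} ⊆ V := by
  by_contra! h
  simp only [not_subset] at h
  choose a ha haV using h
  have hcomp : IsCompact (Set.univ.pi fun i => Set.Iic (m i)) :=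
    isCompact_univ_pi fun i => (Set.finite_Iic (m i)).isCompact
  let b : ℕ → ℕ → ℕ := fun n i => if i < n then a n i else 0
  have hb : ∀ n, b n ∈ (Set.univ.pi fun i => Set.Iic (m i)) := by
    intro n i _
    simp only [b, mem_Iic]
    split_ifs with hi
    · exact ha n i hi
    · exact Nat.zero_le _
  obtain ⟨x, hx, φ, hφ, hlim⟩ := hcomp.tendsto_subseq hb
  have hlim2 : Tendsto (fun n => a (φ n)) atTop (𝓝 x) := by
    rw [tendsto_pi_nhds] at hlim ⊢
    intro i
    refine (hlim i).congr' ?_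
    filter_upwards [eventually_gt_atTop i] with n hn
    have : i < φ n := lt_of_lt_of_le hn (hφ.id_le n)
    simp [b, this]
  have := hlim2.eventually (hV.mem_nhds (hK hx))
  obtain ⟨n, hn⟩ := this.exists
  exact haV _ hn

open Set Filter Topology in
theorem innerApprox {X : Type*} [MeasurableSpace X] [TopologicalSpace X] [PolishSpace X]
    [BorelSpace X] (η : Measure X) [IsFiniteMeasure η]
    (f : (ℕ → ℕ) → X) (hf : Continuous f) (ε : ℝ≥0∞) (hε : ε ≠ 0) :
    ∃ C ⊆ range f, MeasurableSet C ∧ η (range f) ≤ η C + ε := by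
  obtain ⟨δ, hδ, hsum⟩ := ENNReal.exists_pos_sum_of_countable' hε ℕ
  have hstep : ∀ (S : Set (ℕ → ℕ)) (n : ℕ), ∃ k : ℕ,
      η (f '' S) ≤ η (f '' (S ∩ {a | a n ≤ k})) + δ n :=
    fun S n => capStep η f S n (δ n) (hδ n).ne'
  choose k hk using hstep
  let S : ℕ → Set (ℕ → ℕ) := fun n =>
    Nat.rec univ (fun n S => S ∩ {a | a n ≤ k S n}) n
  have S0 : S 0 = univ := rfl
  have Ss : ∀ n, S (n+1) = S n ∩ {a | a n ≤ k (S n) n} := fun n => rfl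
  let m : ℕ → ℕ := fun n => k (S n) n
  have hS : ∀ n, S n = {a | ∀ i < n, a i ≤ m i} := by
    intro n
    induction n with
    | zero => simp [S0]
    | succ n ih =>
      rw [Ss]
      conv_lhs => rw [ih]
      ext a
      simp only [mem_inter_iff, mem_ofPred_eq, Nat.lt_succ_iff_lt_or_eq]
      constructor
      · rintro ⟨h1, h2⟩ i (hi | rfl)
        · exact h1 i hi
        · rw [← ih] at h2; exact h2
      · intro h
        refine ⟨fun i hi => h i (Or.inl hi), ?_⟩
        rw [← ih]
        exact h n (Or.inr rfl)
  have hmeas : ∀ n, η (range f) ≤ η (f '' S n) + ∑ i ∈ Finset.range n, δ i := by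
    intro n
    induction n with
    | zero => simp [S0]
    | succ n ih =>
      refine ih.trans ?_
      rw [Finset.sum_range_succ, add_comm _ (δ n), ← add_assoc]
      gcongr
      rw [Ss]
      exact hk _ _
  have hmeas' : ∀ n, η (range f) ≤ η (f '' S n) + ε := fun n =>
    (hmeas n).trans (by gcongr; exact (ENNReal.sum_le_tsum _).trans hsum.le)
  have hcomp : IsCompact (Set.univ.pi fun i => Set.Iic (m i)) :=
    isCompact_univ_pi fun i => (Set.finite_Iic (m i)).isCompact
  refine ⟨f '' (Set.univ.pi fun i => Set.Iic (m i)), image_subset_range _ _,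
    (hcomp.image hf).isClosed.measurableSet, ?_⟩
  refine ENNReal.le_of_forall_pos_le_add fun e he _ => ?_
  obtain ⟨U, hUsub, hUo, hU⟩ := Set.exists_isOpen_lt_add (μ := η)
    (f '' (Set.univ.pi fun i => Set.Iic (m i))) (measure_ne_top _ _)
    (ε := (e : ℝ≥0∞)) (by exact_mod_cast he.ne')
  obtain ⟨n, hn⟩ := boxSubset m (f ⁻¹' U) (hUo.preimage hf) (image_subset_iff.1 hUsub)
  calc η (range f) ≤ η (f '' S n) + ε := hmeas' n
    _ ≤ η U + ε := by
      gcongr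
      rw [hS n]
      exact image_subset_iff.2 hn
    _ ≤ (η (f '' (Set.univ.pi fun i => Set.Iic (m i))) + e) + ε := by gcongr
    _ = _ := by rw [add_right_comm]

open Set Filter Topology in
theorem analyticNull {X : Type*} [MeasurableSpace X] [TopologicalSpace X] [PolishSpace X]
    [BorelSpace X] (η : Measure X) [IsFiniteMeasure η] (A : Set X) (hA : AnalyticSet A) :
    NullMeasurableSet A η := by
  rw [AnalyticSet_def] at hA
  rcases hA with rfl | ⟨f, hf, rfl⟩
  · exact nullMeasurableSet_empty
  have h : ∀ n : ℕ, ∃ C ⊆ range f, MeasurableSet C ∧ η (range f) ≤ η C + (n : ℝ≥0∞)⁻¹ :=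
    fun n => innerApprox η f hf _ (by simp)
  choose C hC hCm hCη using h
  have hm : MeasurableSet (⋃ n, C n) := MeasurableSet.iUnion hCm
  refine hm.nullMeasurableSet.congr
    (ae_eq_of_subset_of_measure_ge (iUnion_subset hC) ?_ hm.nullMeasurableSet
      (measure_ne_top _ _))
  have ht : Tendsto (fun n : ℕ => η (⋃ n, C n) + (n : ℝ≥0∞)⁻¹) atTop (𝓝 (η (⋃ n, C n) + 0)) :=
    tendsto_const_nhds.add ENNReal.tendsto_inv_nat_nhds_zero
  rw [add_zero] at ht
  refine ge_of_tendsto' ht fun n => (hCη n).trans ?_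
  gcongr
  exact subset_iUnion C n

open Set Filter Topology in
theorem sectionNull {X : Type*} [MeasurableSpace X] [TopologicalSpace X] [PolishSpace X]
    [BorelSpace X] (η : Measure X) [IsFiniteMeasure η]
    (g : (ℕ → ℕ) → X) (hg : Continuous g) (hsurj : Function.Surjective g) :
    ∃ s : X → (ℕ → ℕ), NullMeasurable s η ∧ ∀ x, g (s x) = x := by
  classical
  let A : ℕ → List ℕ → Set X := fun n l => g '' {a | PiNat.res a n = l}
  have hA : ∀ n l, NullMeasurableSet (A n l) η := by
    intro n l
    apply analyticNull
    have hcl : IsClosed {a : ℕ → ℕ | PiNat.res a n = l} := by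
      by_cases h : ∃ b : ℕ → ℕ, PiNat.res b n = l
      · obtain ⟨b, rfl⟩ := h
        have : {a : ℕ → ℕ | PiNat.res a n = PiNat.res b n} = ⋂ i, ⋂ (_ : i < n), {a | a i = b i} := by
          ext a
          simp only [mem_ofPred_eq, PiNat.res_eq_res, mem_iInter]
        rw [this]
        exact isClosed_iInter fun i => isClosed_iInter fun _ =>
          isClosed_eq (continuous_apply i) continuous_const
      · push Not at h
        have : {a : ℕ → ℕ | PiNat.res a n = l} = ∅ := by
          ext a; simp [h a]
        rw [this]; exact isClosed_empty
    exact hcl.analyticSet.image_of_continuous hg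
  let next : ℕ → List ℕ → X → ℕ := fun n l x => sInf {k | x ∈ A (n+1) (k :: l)}
  let p : ℕ → X → List ℕ := fun n x => Nat.rec [] (fun n l => next n l x :: l) n
  have p0 : ∀ x, p 0 x = [] := fun x => rfl
  have ps : ∀ n x, p (n+1) x = next n (p n x) x :: p n x := fun n x => rfl
  let s : X → ℕ → ℕ := fun x n => next n (p n x) x
  have hps : ∀ n x, p n x = PiNat.res (s x) n := by
    intro n x
    induction n with
    | zero => simp [p0]
    | succ n ih => rw [ps, PiNat.res_succ, ← ih]
  have hmem : ∀ n x, x ∈ A n (p n x) := by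
    intro n x
    induction n with
    | zero =>
      obtain ⟨a, rfl⟩ := hsurj x
      exact ⟨a, by simp [p0], rfl⟩
    | succ n ih =>
      obtain ⟨a, ha, hax⟩ := ih
      have hne : {k | x ∈ A (n+1) (k :: p n x)}.Nonempty :=
        ⟨a n, a, by simp only [mem_ofPred_eq] at ha; simp [PiNat.res_succ, ha], hax⟩
      exact Nat.sInf_mem hne
  refine ⟨s, ?_, ?_⟩
  · have hnext : ∀ n l, NullMeasurable (next n l) η := by
      intro n l
      refine @measurable_to_countable' ℕ (NullMeasurableSpace X η) _ _ _ _ fun k => ?_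
      have hAm : ∀ j, @MeasurableSet (NullMeasurableSpace X η) _ (A (n+1) (j :: l)) :=
        fun j => hA _ _
      have : next n l ⁻¹' {k} =
          (A (n+1) (k :: l) ∩ ⋂ j, ⋂ (_ : j < k), (A (n+1) (j :: l))ᶜ) ∪
          ({_x | k = 0} ∩ ⋂ j, (A (n+1) (j :: l))ᶜ) := by
        ext x
        simp only [mem_preimage, mem_singleton_iff, next, mem_union, mem_inter_iff, mem_iInter,
          mem_compl_iff, mem_ofPred_eq]
        constructor
        · intro h
          by_cases hne : {k | x ∈ A (n+1) (k :: l)}.Nonempty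
          · left
            subst h
            exact ⟨Nat.sInf_mem hne, fun j hj => Nat.notMem_of_lt_sInf hj⟩
          · right
            rw [Set.not_nonempty_iff_eq_empty] at hne
            rw [hne, Nat.sInf_empty] at h
            refine ⟨h.symm, fun j hj => ?_⟩
            have : j ∈ {k | x ∈ A (n+1) (k :: l)} := hj
            rw [hne] at this
            exact this
        · rintro (⟨h1, h2⟩ | ⟨rfl, h⟩)
          · apply le_antisymm (Nat.sInf_le h1)
            by_contra! hlt
            exact h2 _ hlt (Nat.sInf_mem (s := {k | x ∈ A (n+1) (k :: l)}) ⟨k, h1⟩)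
          · have : {k | x ∈ A (n+1) (k :: l)} = ∅ := by
              ext j; simpa using h j
            rw [this, Nat.sInf_empty]
      refine Eq.subst (motive := fun Z : Set X => NullMeasurableSet Z η) this.symm ?_
      exact ((hAm k).inter (MeasurableSet.iInter fun j => MeasurableSet.iInter fun _ =>
        (hAm j).compl)).union ((MeasurableSet.const _).inter
          (MeasurableSet.iInter fun j => (hAm j).compl))
    letI : MeasurableSpace (List ℕ) := ⊤
    haveI : MeasurableSingletonClass (List ℕ) := ⟨fun _ => trivial⟩
    have hjoint : ∀ n, Measurable
        (fun q : NullMeasurableSpace X η × List ℕ => next n q.2 q.1) := fun n =>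
      measurable_from_prod_countable_left (fun l => hnext n l)
    have hp : ∀ n, @Measurable (NullMeasurableSpace X η) (List ℕ) _ _ (p n) := by
      intro n
      induction n with
      | zero => exact measurable_const
      | succ n ih =>
        have h1 : Measurable (fun q : ℕ × List ℕ => q.1 :: q.2) :=
          measurable_of_countable _
        exact h1.comp (((hjoint n).comp (measurable_id.prodMk ih)).prodMk ih)
    exact measurable_pi_iff.2 fun n => (hjoint n).comp (measurable_id.prodMk (hp n))
  · intro x
    choose a ha hax using fun n => hmem n x
    have hlim : Tendsto a atTop (𝓝 (s x)) := by
      rw [tendsto_pi_nhds]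
      intro i
      refine tendsto_const_nhds.congr' ?_
      filter_upwards [eventually_gt_atTop i] with n hn
      have := ha n
      simp only [mem_ofPred_eq, hps, PiNat.res_eq_res] at this
      exact (this hn).symm
    have h1 := (hg.tendsto (s x)).comp hlim
    have h2 : (g ∘ a) = fun _ => x := funext hax
    rw [h2] at h1
    exact tendsto_nhds_unique h1 tendsto_const_nhds

open Set Filter Topology in
theorem selectionAE {X Y : Type*}
    [MeasurableSpace X] [TopologicalSpace X] [PolishSpace X] [BorelSpace X]
    [MeasurableSpace Y] [TopologicalSpace Y] [PolishSpace Y] [BorelSpace Y]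
    (η : Measure X) [IsFiniteMeasure η] (hne : Nonempty X)
    (D : Set (X × Y)) (hD : MeasurableSet D) (hfull : ∀ x, ∃ y, (x, y) ∈ D) :
    ∃ T : X → Y, Measurable T ∧ ∀ᵐ x ∂η, (x, T x) ∈ D := by
  have hDa : AnalyticSet D := hD.analyticSet
  rw [AnalyticSet_def] at hDa
  rcases hDa with rfl | ⟨f, hf, rfl⟩
  · obtain ⟨y, hy⟩ := hfull hne.some
    exact hy.elim
  obtain ⟨s, hs, hsx⟩ := sectionNull η (fun a => (f a).1) (continuous_fst.comp hf) (by
    intro x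
    obtain ⟨y, a, ha⟩ := hfull x
    exact ⟨a, by simp [ha]⟩)
  have hT : AEMeasurable (fun x => (f (s x)).2) η := by
    apply NullMeasurable.aemeasurable
    exact (continuous_snd.comp hf).measurable.comp_nullMeasurable hs
  refine ⟨hT.mk _, hT.measurable_mk, ?_⟩
  filter_upwards [hT.ae_eq_mk] with x hx
  rw [← hx]
  refine ⟨s x, ?_⟩
  ext
  · exact hsx x
  · rfl

theorem bindUniv {X Y : Type*} [MeasurableSpace X] [MeasurableSpace Y]
    (κ : Kernel X Y) [IsMarkovKernel κ] (α : Measure X) :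
    (α.bind (fun x => κ x)) Set.univ = α Set.univ := by
  rw [Measure.bind_apply MeasurableSet.univ κ.measurable.aemeasurable]
  simp

theorem bindAdd {X Y : Type*} [MeasurableSpace X] [MeasurableSpace Y]
    (κ : Kernel X Y) (α β : Measure X) :
    (α + β).bind (fun x => κ x) = α.bind (fun x => κ x) + β.bind (fun x => κ x) := by
  ext s hs
  rw [Measure.add_apply, Measure.bind_apply hs κ.measurable.aemeasurable,
    Measure.bind_apply hs κ.measurable.aemeasurable,
    Measure.bind_apply hs κ.measurable.aemeasurable, lintegral_add_measure]

theorem bindMono {X Y : Type*} [MeasurableSpace X] [MeasurableSpace Y]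
    (κ : Kernel X Y) (α β : Measure X) (h : α ≤ β) :
    α.bind (fun x => κ x) ≤ β.bind (fun x => κ x) := by
  refine Measure.le_iff.2 fun s hs => ?_
  rw [Measure.bind_apply hs κ.measurable.aemeasurable,
    Measure.bind_apply hs κ.measurable.aemeasurable]
  exact lintegral_mono' h le_rfl

/-- Half of the construction: modify `κ` on a null set of `μ₁ - μ₂`. -/
theorem halfKernel {X Y : Type*} [MeasurableSpace X] [MeasurableSpace Y]
    (μ₁ μ₂ : Measure X) (ν₁ ν₂ : Measure Y) [IsFiniteMeasure μ₁] [IsFiniteMeasure μ₂]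
    [IsFiniteMeasure ν₁] [IsFiniteMeasure ν₂]
    (hbal : μ₂ Set.univ = ν₂ Set.univ)
    (κ : Kernel X Y) [IsMarkovKernel κ]
    (h1 : ν₁ ≤ μ₁.bind (fun x => κ x)) (h2 : ν₂ ≤ μ₂.bind (fun x => κ x))
    (η : Measure X) (c : X → Y → ℝ≥0∞) (hc : Measurable (Function.uncurry c))
    (T : X → Y) (hT : Measurable T) (hTc : ∀ᵐ x ∂η, c x (T x) = 0)
    (s : Set X) (hs : MeasurableSet s) (hs0 : (μ₁ - μ₂) s = 0) :
    (⨅ κ ∈ {κ : Kernel X Y | IsKernelLe κ (μ₁ - μ₂) (ν₁ - ν₂)}, kernelCost c η κ)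
      ≤ ∫⁻ x in sᶜ, ∫⁻ y, c x y ∂(κ x) ∂η := by
  classical
  let κ' : Kernel X Y := Kernel.piecewise hs (Kernel.deterministic T hT) κ
  have hM : IsMarkovKernel κ' := by infer_instance
  have hbind : (μ₁ - μ₂).bind (fun x => κ' x) = (μ₁ - μ₂).bind (fun x => κ x) := by
    apply Measure.bind_congr_right
    have : ∀ᵐ x ∂(μ₁ - μ₂), x ∉ s := measure_eq_zero_iff_ae_notMem.1 hs0
    filter_upwards [this] with x hx
    simp [κ', Kernel.piecewise_apply, hx]
  have hν2 : ν₂ = μ₂.bind (fun x => κ x) :=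
    Measure.eq_of_le_of_measure_univ_eq h2 (by rw [bindUniv, hbal])
  have hle : IsKernelLe κ' (μ₁ - μ₂) (ν₁ - ν₂) := by
    refine ⟨hM, ?_⟩
    rw [hbind]
    apply Measure.sub_le_of_le_add
    refine h1.trans ?_
    conv_rhs => rw [hν2]
    rw [← bindAdd]
    exact bindMono _ _ _ (Measure.sub_le_iff_le_add.1 le_rfl)
  refine (iInf₂_le κ' hle).trans ?_
  rw [← lintegral_indicator hs.compl]
  apply le_of_eq
  apply lintegral_congr_ae
  filter_upwards [hTc] with x hx
  by_cases h : x ∈ s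
  · simp only [κ', Kernel.piecewise_apply, h, if_true, Kernel.deterministic_apply]
    rw [lintegral_dirac' (f := c x) _ (hc.comp measurable_prodMk_left)]
    simp [hx, h]
  · simp [κ', Kernel.piecewise_apply, h]

theorem stmt4 {X Y : Type*}
    [MeasurableSpace X] [TopologicalSpace X] [PolishSpace X] [BorelSpace X]
    [MeasurableSpace Y] [TopologicalSpace Y] [PolishSpace Y] [BorelSpace Y]
    {d : ℕ} (μ : Fin d → Measure X) (ν : Fin d → Measure Y)
    (hμfin : ∀ j, IsFiniteMeasure (μ j)) (hνfin : ∀ j, IsFiniteMeasure (ν j))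
    (hμ0 : ∀ j, μ j ≠ 0) (hν0 : ∀ j, ν j ≠ 0)
    (hbal : ∀ j, μ j Set.univ = ν j Set.univ)
    (η : Measure X) (hη : IsProbabilityMeasure η) (hac : η ≪ avg μ)
    (c : X → Y → ℝ≥0∞) (hc : Measurable (Function.uncurry c))
    (hc0 : ∀ x : X, ∃ y : Y, c x y = 0) :
    (∀ i j : Fin d,
      (⨅ κ ∈ {κ : Kernel X Y | IsKernelLe κ (μ i - μ j) (ν i - ν j)},
          kernelCost c η κ) +
      (⨅ κ ∈ {κ : Kernel X Y | IsKernelLe κ (μ j - μ i) (ν j - ν i)},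
          kernelCost c η κ)
        ≤ ⨅ κ ∈ {κ : Kernel X Y | IsSimulKernel κ μ ν}, kernelCost c η κ) ∧
    (∀ i j : Fin d, (μ i - μ j) Set.univ < (ν i - ν j) Set.univ →
      (⨅ κ ∈ {κ : Kernel X Y | IsSimulKernel κ μ ν}, kernelCost c η κ) = ⊤ ∧
      (⨅ κ ∈ {κ : Kernel X Y | IsKernelLe κ (μ i - μ j) (ν i - ν j)},
          kernelCost c η κ) +
      (⨅ κ ∈ {κ : Kernel X Y | IsKernelLe κ (μ j - μ i) (ν j - ν i)},
          kernelCost c η κ) = ⊤) := by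
  have hne : Nonempty X := by
    by_contra hX
    rw [not_nonempty_iff] at hX
    have h1 : η Set.univ = 1 := measure_univ
    rw [Set.univ_eq_empty_iff.2 hX] at h1
    simp at h1
  obtain ⟨T, hT, hTc⟩ := selectionAE η hne {p : X × Y | c p.1 p.2 = 0}
    (hc (measurableSet_singleton 0)) hc0
  have main : ∀ i j : Fin d,
      (⨅ κ ∈ {κ : Kernel X Y | IsKernelLe κ (μ i - μ j) (ν i - ν j)},
          kernelCost c η κ) +
      (⨅ κ ∈ {κ : Kernel X Y | IsKernelLe κ (μ j - μ i) (ν j - ν i)},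
          kernelCost c η κ)
        ≤ ⨅ κ ∈ {κ : Kernel X Y | IsSimulKernel κ μ ν}, kernelCost c η κ := by
    intro i j
    refine le_iInf₂ fun κ hκ => ?_
    obtain ⟨hM, hκ⟩ := hκ
    have := hμfin i
    have := hμfin j
    have := hνfin i
    have := hνfin j
    obtain ⟨s, hs⟩ := exists_isHahnDecomposition (μ i) (μ j)
    have e1 := halfKernel (μ i) (μ j) (ν i) (ν j) (hbal j) κ (hκ i) (hκ j) η c hc T hT hTc
      s hs.measurableSet (Measure.sub_apply_eq_zero_of_isHahnDecomposition hs)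
    have e2 := halfKernel (μ j) (μ i) (ν j) (ν i) (hbal i) κ (hκ j) (hκ i) η c hc T hT hTc
      sᶜ hs.measurableSet.compl (Measure.sub_apply_eq_zero_of_isHahnDecomposition hs.compl)
    refine (add_le_add e1 e2).trans (le_of_eq ?_)
    exact lintegral_add_compl _ hs.measurableSet.compl
  refine ⟨main, fun i j hlt => ?_⟩
  have htop : (⨅ κ ∈ {κ : Kernel X Y | IsKernelLe κ (μ i - μ j) (ν i - ν j)},
          kernelCost c η κ) = ⊤ := by
    rw [iInf₂_eq_top]
    rintro κ ⟨hM, hκ⟩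
    have h1 := hκ Set.univ
    rw [bindUniv] at h1
    exact absurd hlt (not_lt.2 h1)
  have hsum : (⨅ κ ∈ {κ : Kernel X Y | IsKernelLe κ (μ i - μ j) (ν i - ν j)},
          kernelCost c η κ) +
      (⨅ κ ∈ {κ : Kernel X Y | IsKernelLe κ (μ j - μ i) (ν j - ν i)},
          kernelCost c η κ) = ⊤ := by
    rw [htop, top_add]
  exact ⟨top_le_iff.1 (hsum ▸ main i j), hsum⟩


end
end

section
/- Let X and Y be Polish spaces, let μ and ν be d-tuples of finite nonzero Borel measures on X and Y with μ_j(X) ≥ ν_j(Y) for all j, and let η be a Borel probability measure on X with η ∼ μ̄ (η and μ̄ mutually absolutely continuous). Then Π_η(μ,ν) equals the set of all Borel probability measures π on X×Y such that π(A×Y) = η(A) for every Borel A ⊆ X and ∫_{X×B} (dμ_j/dη)(x) dπ(x,y) ≥ ν_j(B) for every j ∈ {1,…,d} and every Borel B ⊆ Y, where dμ_j/dη denotes any Borel-measurable version of the Radon–Nikodym derivative. -/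
open MeasureTheory ProbabilityTheory ENNReal

noncomputable section

theorem stmt5 {X Y : Type*}
    [MeasurableSpace X] [TopologicalSpace X] [PolishSpace X] [BorelSpace X]
    [MeasurableSpace Y] [TopologicalSpace Y] [PolishSpace Y] [BorelSpace Y]
    {d : ℕ} (μ : Fin d → Measure X) (ν : Fin d → Measure Y)
    (hμfin : ∀ j, IsFiniteMeasure (μ j)) (hνfin : ∀ j, IsFiniteMeasure (ν j))
    (hμ0 : ∀ j, μ j ≠ 0) (hν0 : ∀ j, ν j ≠ 0)
    (hdom : ∀ j, ν j Set.univ ≤ μ j Set.univ)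
    (η : Measure X) (hη : IsProbabilityMeasure η)
    (h1 : η ≪ avg μ) (h2 : avg μ ≪ η)
    (g : Fin d → X → ℝ≥0∞) (hg : ∀ j, Measurable (g j))
    (hgd : ∀ j, μ j = η.withDensity (g j)) :
    PiSet η μ ν =
      {π : Measure (X × Y) | IsProbabilityMeasure π ∧
        (∀ A : Set X, MeasurableSet A → π (A ×ˢ (Set.univ : Set Y)) = η A) ∧
        ∀ j, ∀ B : Set Y, MeasurableSet B →
          ν j B ≤ ∫⁻ p in (Set.univ : Set X) ×ˢ B, g j p.1 ∂π} := by
  have key : ∀ (κ : Kernel X Y) [IsMarkovKernel κ] (j : Fin d) (B : Set Y), MeasurableSet B →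
      ∫⁻ p in (Set.univ : Set X) ×ˢ B, g j p.1 ∂(η.compProd κ)
        = (μ j).bind (fun x => κ x) B := by
    intro κ _ j B hB
    rw [Measure.setLIntegral_compProd (f := fun p : X × Y => g j p.1) ((hg j).comp measurable_fst) MeasurableSet.univ hB,
      Measure.bind_apply hB κ.measurable.aemeasurable, hgd j,
      lintegral_withDensity_eq_lintegral_mul _ (hg j) (κ.measurable_coe hB)]
    simp [lintegral_const]
  ext π
  constructor
  · rintro ⟨κ, ⟨hκ, hle⟩, rfl⟩
    refine ⟨inferInstance, fun A hA => ?_, fun j B hB => ?_⟩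
    · rw [Measure.compProd_apply_prod hA MeasurableSet.univ]
      simp
    · rw [key κ j B hB]
      exact hle j B
  · rintro ⟨hπ, hfst, hle⟩
    have hne : Nonempty Y := by
      obtain ⟨p⟩ := nonempty_of_isProbabilityMeasure π
      exact ⟨p.2⟩
    have hf : π.fst = η := by
      ext A hA
      rw [Measure.fst_apply hA, ← hfst A hA, Set.prod_univ]
    have hd : η.compProd π.condKernel = π := by
      rw [← hf]
      exact π.disintegrate π.condKernel
    refine ⟨π.condKernel, ⟨inferInstance, fun j => ?_⟩, hd.symm⟩
    refine Measure.le_iff.2 fun B hB => ?_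
    rw [← key _ j B hB, hd]
    exact hle j B hB

end
end

section
/- Let X and Y be compact Polish spaces, let μ and ν be d-tuples of finite nonzero Borel measures on X and Y, let η be a Borel probability measure on X with η ∼ μ̄ (mutually absolutely continuous), assume μ is jointly atomless, and let c : X×Y → [0,∞) be continuous. Then the infimum over κ ∈ K(μ,ν) of C_η(κ) equals the infimum over T ∈ T(μ,ν) of C_η(T). -/
open MeasureTheory ProbabilityTheory ENNReal

noncomputable section

lemma cdf_cont_aux (m : Measure ℝ) [IsProbabilityMeasure m] (h : ∀ r, m {r} = 0) :
    Continuous (cdf m) := by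
  rw [continuous_iff_continuousAt]
  intro x
  rw [(monotone_cdf m).continuousAt_iff_leftLim_eq_rightLim]
  have h1 := (cdf m).measure_singleton x
  rw [measure_cdf, h] at h1
  have h2 : (cdf m) x - Function.leftLim (cdf m) x ≤ 0 := by
    simpa using h1.symm
  have h3 := (monotone_cdf m).leftLim_le (le_refl x)
  rw [(cdf m).rightLim_eq]
  linarith

lemma pit_aux (m : Measure ℝ) [IsProbabilityMeasure m] (h : ∀ r, m {r} = 0)
    (F : ℝ → unitInterval) (hF : ∀ t, (F t : ℝ) = cdf m t) :
    m.map F = volume := by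
  have hc := cdf_cont_aux m h
  have hmono : Monotone F := fun a b hab => by
    rw [← Subtype.coe_le_coe, hF, hF]; exact monotone_cdf m hab
  have hFm : Measurable F := hmono.measurable
  have ivt : ∀ u : ℝ, 0 < u → u < 1 → ∃ t, cdf m t = u := by
    intro u h0 h1
    obtain ⟨a, ha⟩ := ((tendsto_cdf_atBot m).eventually (eventually_lt_nhds h0)).exists
    obtain ⟨b, hb⟩ := ((tendsto_cdf_atTop m).eventually (eventually_gt_nhds h1)).exists
    exact mem_range_of_exists_le_of_exists_ge hc ⟨a, ha.le⟩ ⟨b, hb.le⟩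
  have hIic : ∀ t, m (Set.Iic t) = ENNReal.ofReal (cdf m t) := fun t => by
    rw [ofReal_cdf]
  have : IsProbabilityMeasure (m.map F) := Measure.isProbabilityMeasure_map hFm.aemeasurable
  refine Measure.ext_of_Iic _ _ fun u => ?_
  rw [Measure.map_apply hFm measurableSet_Iic, unitInterval.volume_Iic]
  apply le_antisymm
  · rcases eq_or_lt_of_le u.2.2 with h1 | h1
    · rw [h1]; simpa using prob_le_one
    · refine le_of_forall_gt_imp_ge_of_dense fun w hw => ?_
      rcases le_or_gt 1 w with hw1 | hw1
      · exact prob_le_one.trans hw1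
      have hwt : w ≠ ∞ := (hw1.trans one_lt_top).ne
      have hw2 : (u : ℝ) < w.toReal := by
        rwa [ENNReal.ofReal_lt_iff_lt_toReal u.2.1 hwt] at hw
      obtain ⟨t, ht⟩ := ivt w.toReal (u.2.1.trans_lt hw2)
        (by simpa using (ENNReal.toReal_lt_toReal hwt one_ne_top).2 hw1)
      calc m (F ⁻¹' Set.Iic u) ≤ m (Set.Iic t) := by
            apply measure_mono
            intro x hx
            by_contra hxt
            simp only [Set.mem_Iic, not_le] at hxt
            have := monotone_cdf m hxt.le
            have h3 : F x ≤ u := hx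
            rw [← Subtype.coe_le_coe, hF] at h3
            linarith
        _ = w := by rw [hIic, ht, ofReal_toReal hwt]
  · rcases eq_or_lt_of_le u.2.1 with h0 | h0
    · rw [← h0]; simp
    rcases eq_or_lt_of_le u.2.2 with h1 | h1
    · have : F ⁻¹' Set.Iic u = Set.univ := by
        ext x; simp only [Set.mem_preimage, Set.mem_Iic, Set.mem_univ, iff_true]
        rw [← Subtype.coe_le_coe, h1]; exact (F x).2.2
      rw [this, h1]; simp
    obtain ⟨t, ht⟩ := ivt u h0 h1
    rw [← ht, ← hIic]
    apply measure_mono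
    intro x hx
    have := monotone_cdf m (show x ≤ t from hx)
    show F x ≤ u
    rw [← Subtype.coe_le_coe, hF]; linarith

lemma core_aux {X S Y : Type*} [MeasurableSpace X] [MeasurableSpace S] [MeasurableSpace Y]
    [StandardBorelSpace Y] [Nonempty Y] (lam : Measure X) [IsProbabilityMeasure lam]
    (Z : X → S) (hZ : Measurable Z) (ξ : X → ℝ) (hξ : Measurable ξ)
    (hat : ∀ r, lam.map ξ {r} = 0)
    (hac : lam.map (fun x => (Z x, ξ x)) ≪ (lam.map Z).prod (lam.map ξ))
    (κ : Kernel X Y) [IsMarkovKernel κ] :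
    ∃ T : X → Y, Measurable T ∧
      lam.map (fun x => (Z x, T x)) = (lam ⊗ₘ κ).map (fun p => (Z p.1, p.2)) := by
  have := Measure.isProbabilityMeasure_map (μ := lam) hZ.aemeasurable
  have := Measure.isProbabilityMeasure_map (μ := lam) hξ.aemeasurable
  have hZξ : Measurable (fun x => (Z x, ξ x)) := by fun_prop
  have hZY : Measurable (fun p : X × Y => (Z p.1, p.2)) := by fun_prop
  set ρ := lam.map (fun x => (Z x, ξ x)) with hρ
  have : IsProbabilityMeasure ρ := Measure.isProbabilityMeasure_map hZξ.aemeasurable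
  set σ := (lam ⊗ₘ κ).map (fun p => (Z p.1, p.2)) with hσ
  have : IsProbabilityMeasure σ := Measure.isProbabilityMeasure_map hZY.aemeasurable
  have hρ1 : ρ.fst = lam.map Z := by
    rw [hρ, Measure.fst_map_prodMk hξ]
  have hσ1 : σ.fst = lam.map Z := by
    rw [hσ, Measure.fst, Measure.map_map measurable_fst hZY]
    have : (Prod.fst ∘ fun p : X × Y => (Z p.1, p.2)) = Z ∘ Prod.fst := rfl
    rw [this, ← Measure.map_map hZ measurable_fst]
    congr 1
    exact Measure.fst_compProd lam κ
  have hρd := ρ.disintegrate ρ.condKernel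
  have hσd := σ.disintegrate σ.condKernel
  rw [hρ1] at hρd
  rw [hσ1] at hσd
  have hK : ∀ᵐ z ∂(lam.map Z), ∀ r, ρ.condKernel z {r} = 0 := by
    rw [← Measure.compProd_const, ← hρd] at hac
    filter_upwards [hac.kernel_of_compProd] with z hz r
    exact hz (by simpa using hat r)
  let U : S → ℝ → unitInterval := fun z t => ⟨cdf (ρ.condKernel z) t, cdf_nonneg _ _, cdf_le_one _ _⟩
  have hU : Measurable (Function.uncurry U) := by
    apply Measurable.subtype_mk
    simp only [cdf_eq_real, measureReal_def]
    apply Measurable.ennreal_toReal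
    have hs : MeasurableSet {q : (S × ℝ) × ℝ | q.2 ≤ q.1.2} :=
      measurableSet_le (by fun_prop) (by fun_prop)
    have := Kernel.measurable_kernel_prodMk_left
      (κ := ρ.condKernel.comap (Prod.fst : S × ℝ → S) measurable_fst) hs
    exact this
  obtain ⟨f, hf, hfκ⟩ := σ.condKernel.exists_measurable_map_eq_unitInterval
  have hG : Measurable (fun p : S × ℝ => (p.1, f p.1 (U p.1 p.2))) := by
    refine measurable_fst.prodMk ?_
    exact hf.comp (measurable_fst.prodMk hU)
  refine ⟨fun x => f (Z x) (U (Z x) (ξ x)), (measurable_snd.comp hG).comp hZξ, ?_⟩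
  have h1 : lam.map (fun x => (Z x, f (Z x) (U (Z x) (ξ x))))
      = ρ.map (fun p : S × ℝ => (p.1, f p.1 (U p.1 p.2))) := by
    rw [hρ, Measure.map_map hG hZξ]; rfl
  rw [h1, ← hσd]
  ext B hB
  rw [Measure.map_apply hG hB, ← hρd, Measure.compProd_apply (hG hB), Measure.compProd_apply hB]
  refine lintegral_congr_ae ?_
  filter_upwards [hK] with z hz
  have hUz : Measurable (U z) := hU.comp measurable_prodMk_left
  have hfz : Measurable (f z) := hf.comp measurable_prodMk_left
  have h2 := pit_aux (ρ.condKernel z) hz (U z) (fun t => rfl)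
  rw [← hfκ z, Measure.map_apply hfz (measurable_prodMk_left hB), ← h2,
    Measure.map_apply hUz (hfz (measurable_prodMk_left hB))]
  rfl

lemma ac_aux {X S R : Type*} [MeasurableSpace X] [MeasurableSpace S] [MeasurableSpace R]
    [MeasurableSingletonClass R]
    (lam : Measure X) [IsProbabilityMeasure lam]
    (g : X → S) (hg : Measurable g) (ξ : X → ℝ) (hξ : Measurable ξ) (W : SimpleFunc X R)
    (hind : IndepFun ξ g lam) :
    lam.map (fun x => ((g x, W x), ξ x)) ≪
      (lam.map (fun x => (g x, W x))).prod (lam.map ξ) := by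
  have hW : Measurable W := W.measurable
  have := Measure.isProbabilityMeasure_map (μ := lam) hξ.aemeasurable
  have := Measure.isProbabilityMeasure_map (μ := lam) hg.aemeasurable
  have hprod : lam.map (fun x => (g x, ξ x)) = (lam.map g).prod (lam.map ξ) :=
    (indepFun_iff_map_prod_eq_prod_map_map hg.aemeasurable hξ.aemeasurable).1 hind.symm
  refine Measure.AbsolutelyContinuous.mk fun N hN h0 => ?_
  rw [Measure.map_apply (by fun_prop) hN]
  rw [Measure.measure_prod_null hN] at h0
  have h0' := ae_of_ae_map (by fun_prop) h0
  have key : ∀ w ∈ W.range, lam {x | W x = w ∧ ((g x, w), ξ x) ∈ N} = 0 := by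
    intro w _
    let Nw : Set (S × ℝ) := {p | ((p.1, w), p.2) ∈ N}
    have hNw : MeasurableSet Nw := hN.preimage (by fun_prop)
    let B : Set S := {s | lam.map ξ (Prod.mk s ⁻¹' Nw) = 0}
    have hB : MeasurableSet B := (measurable_measure_prodMk_left hNw) (measurableSet_singleton 0)
    have hD : MeasurableSet (Nw ∩ Prod.fst ⁻¹' B) := hNw.inter (measurable_fst hB)
    have h3 : lam ((fun x => (g x, ξ x)) ⁻¹' (Nw ∩ Prod.fst ⁻¹' B)) = 0 := by
      rw [← Measure.map_apply (by fun_prop) hD, hprod, Measure.measure_prod_null hD]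
      refine Filter.Eventually.of_forall fun s => ?_
      by_cases hs : s ∈ B
      · exact measure_mono_null (fun t ht => ht.1) hs
      · have : Prod.mk s ⁻¹' (Nw ∩ Prod.fst ⁻¹' B) = ∅ := by
          ext t; simp [hs]
        simp [this]
    refine measure_mono_null ?_ (measure_union_null h3 h0')
    rintro x ⟨hx1, hx2⟩
    by_cases hb : g x ∈ B
    · exact Or.inl ⟨hx2, hb⟩
    · refine Or.inr fun h4 => hb ?_
      have : lam.map ξ (Prod.mk (g x, W x) ⁻¹' N) = 0 := h4
      rw [hx1] at this
      exact this
  refine measure_mono_null ?_ ((measure_biUnion_null_iff W.range.countable_toSet).2 key)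
  intro x hx
  simp only [Set.mem_iUnion]
  exact ⟨W x, W.mem_range_self x, rfl, hx⟩

lemma k_aux {X Y : Type*}
    [MeasurableSpace X] [TopologicalSpace X] [PolishSpace X] [BorelSpace X]
    [TopologicalSpace Y] [PolishSpace Y] [Nonempty X]
    [CompactSpace X] [CompactSpace Y] 
    (c : X → Y → ℝ) (hc : Continuous (Function.uncurry c)) (ε : ℝ) (hε : 0 < ε) :
    ∃ k : SimpleFunc X X, ∀ x y, |c x y - c (k x) y| < ε := by
  let := TopologicalSpace.upgradeIsCompletelyMetrizable X
  let := TopologicalSpace.upgradeIsCompletelyMetrizable Y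
  have huc := CompactSpace.uniformContinuous_of_continuous hc
  obtain ⟨δ, hδ, h⟩ := Metric.uniformContinuous_iff.1 huc ε hε
  let e := TopologicalSpace.denseSeq X
  have hcov : (Set.univ : Set X) ⊆ ⋃ n, Metric.ball (e n) δ := by
    intro x _
    obtain ⟨n, hn⟩ := (TopologicalSpace.denseRange_denseSeq X).exists_dist_lt x hδ
    exact Set.mem_iUnion.2 ⟨n, hn⟩
  obtain ⟨t, ht⟩ := isCompact_univ.elim_finite_subcover _ (fun n => Metric.isOpen_ball) hcov
  refine ⟨SimpleFunc.nearestPt e (t.sup id), fun x y => ?_⟩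
  have hx := ht (Set.mem_univ x)
  simp only [Set.mem_iUnion] at hx
  obtain ⟨n, hn, hxn⟩ := hx
  have h1 := SimpleFunc.edist_nearestPt_le e x (Finset.le_sup (f := id) hn)
  have h2 : dist (SimpleFunc.nearestPt e (t.sup id) x) x < δ := by
    rw [edist_dist, edist_dist] at h1
    rw [ENNReal.ofReal_le_ofReal_iff dist_nonneg] at h1
    exact h1.trans_lt (by rw [dist_comm]; exact hxn)
  have := @h (x, y) (SimpleFunc.nearestPt e (t.sup id) x, y) (by
    rw [Prod.dist_eq]; simpa [dist_comm, hδ] using h2)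
  rwa [Real.dist_eq] at this

theorem stmt6 {X Y : Type*}
    [MeasurableSpace X] [TopologicalSpace X] [PolishSpace X] [BorelSpace X]
    [MeasurableSpace Y] [TopologicalSpace Y] [PolishSpace Y] [BorelSpace Y]
    [CompactSpace X] [CompactSpace Y]
    {d : ℕ} (μ : Fin d → Measure X) (ν : Fin d → Measure Y)
    (hμfin : ∀ j, IsFiniteMeasure (μ j)) (hνfin : ∀ j, IsFiniteMeasure (ν j))
    (hμ0 : ∀ j, μ j ≠ 0) (hν0 : ∀ j, ν j ≠ 0)
    (η : Measure X) (hη : IsProbabilityMeasure η)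
    (h1 : η ≪ avg μ) (h2 : avg μ ≪ η)
    (hja : JointlyAtomless μ)
    (c : X → Y → ℝ) (hc : Continuous (Function.uncurry c))
    (hc0 : ∀ x y, 0 ≤ c x y) :
    (⨅ κ ∈ {κ : Kernel X Y | IsSimulKernel κ μ ν},
        kernelCost (fun x y => ENNReal.ofReal (c x y)) η κ)
      = ⨅ T ∈ {T : X → Y | IsSimulMap T μ ν},
          ∫⁻ x, ENNReal.ofReal (c x (T x)) ∂η := by
  have hcm : Measurable (Function.uncurry c) := hc.measurable
  apply le_antisymm
  · refine le_iInf₂ fun T hT => ?_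
    obtain ⟨hTm, hT⟩ := hT
    have hmem : IsSimulKernel (Kernel.deterministic T hTm) μ ν := by
      refine ⟨inferInstance, fun j => ?_⟩
      refine (hT j).trans (le_of_eq ?_)
      ext B hB
      rw [Measure.map_apply hTm hB, Measure.bind_apply hB (Kernel.aemeasurable _)]
      simp only [Kernel.deterministic_apply' _ _ hB]
      rw [← lintegral_indicator_one (hTm hB)]
      rfl
    refine (iInf₂_le (Kernel.deterministic T hTm) hmem).trans ?_
    · apply le_of_eq
      unfold kernelCost
      refine lintegral_congr fun x => ?_
      rw [Kernel.lintegral_deterministic']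
      have : Measurable (fun y => c x y) := hcm.comp measurable_prodMk_left
      fun_prop
  refine le_iInf₂ fun κ hκ => ?_
  obtain ⟨hκM, hκ⟩ := hκ
  obtain ⟨lam, g, ξ, hlam, hg, hξ, hμg, hat, hind⟩ := hja
  have hXne : Nonempty X := nonempty_of_isProbabilityMeasure η
  have hYne : Nonempty Y := nonempty_of_isProbabilityMeasure (κ hXne.some)
  have hηlam : η ≪ lam := by
    refine h1.trans ?_
    unfold avg
    apply Measure.AbsolutelyContinuous.trans Measure.smul_absolutelyContinuous
    refine Measure.AbsolutelyContinuous.mk fun s hs h0 => ?_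
    rw [Measure.finsetSum_apply]
    refine Finset.sum_eq_zero fun j _ => ?_
    rw [hμg j]
    exact withDensity_absolutelyContinuous _ _ h0
  obtain ⟨M, hM0, hM⟩ : ∃ M : ℝ, 0 < M ∧ ∀ x y, c x y ≤ M := by
    obtain ⟨M, hM⟩ := (isCompact_range hc).bddAbove
    refine ⟨max M 1, by positivity, fun x y => ?_⟩
    exact (hM ⟨(x, y), rfl⟩).trans (le_max_left _ _)
  set p := η.rnDeriv lam with hp
  have hpm : Measurable p := Measure.measurable_rnDeriv η lam
  have hηp : lam.withDensity p = η := Measure.withDensity_rnDeriv_eq η lam hηlam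
  have hp1 : ∫⁻ x, p x ∂lam = 1 := by
    have : η Set.univ = 1 := measure_univ
    rwa [← hηp, withDensity_apply _ MeasurableSet.univ, Measure.restrict_univ] at this
  refine _root_.le_of_forall_pos_le_add fun ε hε => ?_
  rcases eq_or_ne ε ∞ with hεt | hεt
  · simp [hεt]
  have hεr : 0 < ε.toReal := ENNReal.toReal_pos hε.ne' hεt
  set δ : ℝ := ε.toReal / 3 with hδ
  have hδ0 : 0 < δ := by positivity
  obtain ⟨k, hk⟩ := k_aux c hc δ hδ0
  obtain ⟨s, hsp, hs⟩ : ∃ s : SimpleFunc X NNReal, (∀ x, (s x : ℝ≥0∞) ≤ p x) ∧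
      ∫⁻ x, (p x - s x) ∂lam ≤ ENNReal.ofReal (δ / M) := by
    have hpos : ENNReal.ofReal (δ / M) ≠ 0 := by
      have : 0 < δ / M := by positivity
      simpa using this
    by_contra! hcon
    have hb : ∀ s : SimpleFunc X NNReal, (∀ x, (s x : ℝ≥0∞) ≤ p x) →
        ∫⁻ x, (s x : ℝ≥0∞) ∂lam + ENNReal.ofReal (δ / M) ≤ 1 := fun s hs => by
      have h3 := hcon s hs
      calc ∫⁻ x, (s x : ℝ≥0∞) ∂lam + ENNReal.ofReal (δ / M)
          ≤ ∫⁻ x, (s x : ℝ≥0∞) ∂lam + ∫⁻ x, (p x - s x) ∂lam := by gcongr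
        _ = ∫⁻ x, (s x + (p x - s x)) ∂lam :=
            (lintegral_add_left (by fun_prop) _).symm
        _ = 1 := by rw [← hp1]; exact lintegral_congr fun x => add_tsub_cancel_of_le (hs x)
    have hsup : ∫⁻ x, p x ∂lam ≤ 1 - ENNReal.ofReal (δ / M) := by
      rw [lintegral_eq_nnreal]
      refine iSup₂_le fun s hs => ?_
      have h3 : (s.map ((↑) : NNReal → ℝ≥0∞)).lintegral lam = ∫⁻ x, (s x : ℝ≥0∞) ∂lam := by
        rw [← SimpleFunc.lintegral_eq_lintegral]; rfl
      rw [h3]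
      exact ENNReal.le_sub_of_add_le_right ENNReal.ofReal_ne_top (hb s hs)
    rw [hp1] at hsup
    exact absurd hsup (not_le.2 (ENNReal.sub_lt_self one_ne_top one_ne_zero hpos))
  let W : SimpleFunc X (NNReal × X) := s.pair k
  let Z : X → (Fin d → ℝ) × (NNReal × X) := fun x => (g x, W x)
  have hWm : Measurable W := W.measurable
  have hsm : Measurable s := s.measurable
  have hkm : Measurable k := k.measurable
  have hZ : Measurable Z := by fun_prop
  obtain ⟨T, hT, hTlaw⟩ := core_aux lam Z hZ ξ hξ (fun r => by
    rw [Measure.map_apply hξ (measurableSet_singleton r)]; exact hat r)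
    (ac_aux lam g hg ξ hξ W hind) κ
  have key : ∀ F : ((Fin d → ℝ) × (NNReal × X)) × Y → ℝ≥0∞, Measurable F →
      ∫⁻ x, F (Z x, T x) ∂lam = ∫⁻ x, ∫⁻ y, F (Z x, y) ∂(κ x) ∂lam := by
    intro F hF
    have hZT : Measurable (fun x => (Z x, T x)) := by fun_prop
    rw [← lintegral_map (f := F) hF hZT, hTlaw,
      lintegral_map hF (by fun_prop), Measure.lintegral_compProd (by fun_prop)]
  have hcE : Measurable (fun q : X × Y => ENNReal.ofReal (c q.1 q.2)) :=
    hcm.ennreal_ofReal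
  have hcT : Measurable (fun x => ENNReal.ofReal (c x (T x))) :=
    hcE.comp (measurable_id.prodMk hT)
  have hcκ : Measurable (fun x => ∫⁻ y, ENNReal.ofReal (c x y) ∂(κ x)) :=
    Measurable.lintegral_kernel_prod_right hcE
  have hmem : IsSimulMap T μ ν := by
    refine ⟨hT, fun j => ?_⟩
    refine (hκ j).trans (le_of_eq ?_)
    ext B hB
    have hgj : Measurable (fun x => ENNReal.ofReal (g x j)) := by fun_prop
    rw [Measure.map_apply hT hB, Measure.bind_apply hB (Kernel.aemeasurable _), hμg j,
      withDensity_apply _ (hT hB), lintegral_withDensity_eq_lintegral_mul _ hgj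
        (κ.measurable_coe hB), ← lintegral_indicator (hT hB)]
    have := key (fun q => ENNReal.ofReal (q.1.1 j) * B.indicator 1 q.2) (by
      have : Measurable (B.indicator (1 : Y → ℝ≥0∞)) := measurable_one.indicator hB
      fun_prop)
    have e1 : ∀ x, ∫⁻ y, ENNReal.ofReal (g x j) * B.indicator 1 y ∂(κ x)
        = ENNReal.ofReal (g x j) * κ x B := fun x => by
      rw [lintegral_const_mul _ (measurable_one.indicator hB), lintegral_indicator_one hB]
    simp only [Z, e1] at this
    simp only [Pi.mul_apply]
    rw [← this]
    refine lintegral_congr fun x => ?_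
    by_cases hx : T x ∈ B <;> simp [hx]
  refine (iInf₂_le T hmem).trans ?_
  · have hsint : ∫⁻ x, (s x : ℝ≥0∞) ∂lam ≤ 1 := by
      rw [← hp1]; exact lintegral_mono hsp
    have hF : Measurable (fun q : ((Fin d → ℝ) × (NNReal × X)) × Y =>
        (q.1.2.1 : ℝ≥0∞) * ENNReal.ofReal (c q.1.2.2 q.2)) := by
      have hq1 : Measurable (fun q : ((Fin d → ℝ) × (NNReal × X)) × Y => (q.1.2.1 : ℝ≥0∞)) := by
        fun_prop
      refine Measurable.mul hq1 ?_
      have hq : Measurable (fun q : ((Fin d → ℝ) × (NNReal × X)) × Y => (q.1.2.2, q.2)) := by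
        fun_prop
      exact hcE.comp hq
    have hkey := key _ hF
    simp only [Z, W, SimpleFunc.pair_apply] at hkey
    have hle1 : ∀ x y, ENNReal.ofReal (c x y) ≤ ENNReal.ofReal (c (k x) y) + ENNReal.ofReal δ := by
      intro x y
      rw [← ENNReal.ofReal_add (hc0 _ _) hδ0.le]
      apply ENNReal.ofReal_le_ofReal
      have := (abs_lt.1 (hk x y)).2
      linarith
    have hle2 : ∀ x y, ENNReal.ofReal (c (k x) y) ≤ ENNReal.ofReal (c x y) + ENNReal.ofReal δ := by
      intro x y
      rw [← ENNReal.ofReal_add (hc0 _ _) hδ0.le]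
      apply ENNReal.ofReal_le_ofReal
      have := (abs_lt.1 (hk x y)).1
      linarith
    have hsE : Measurable (fun x => (s x : ℝ≥0∞)) := by fun_prop
    have hckT : Measurable (fun x => ENNReal.ofReal (c (k x) (T x))) :=
      hcE.comp (hkm.prodMk hT)
    calc ∫⁻ x, ENNReal.ofReal (c x (T x)) ∂η
        = ∫⁻ x, p x * ENNReal.ofReal (c x (T x)) ∂lam := by
          conv_lhs => rw [← hηp]
          rw [lintegral_withDensity_eq_lintegral_mul _ hpm hcT]; rfl
      _ ≤ ∫⁻ x, ((s x * ENNReal.ofReal (c (k x) (T x)) + s x * ENNReal.ofReal δ)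
            + (p x - s x) * ENNReal.ofReal M) ∂lam := by
          refine lintegral_mono fun x => ?_
          calc p x * ENNReal.ofReal (c x (T x))
              = (s x + (p x - s x)) * ENNReal.ofReal (c x (T x)) := by
                rw [add_tsub_cancel_of_le (hsp x)]
            _ = s x * ENNReal.ofReal (c x (T x)) + (p x - s x) * ENNReal.ofReal (c x (T x)) :=
                add_mul _ _ _
            _ ≤ _ := by
                rw [← mul_add]
                gcongr
                · exact hle1 x _
                · exact hM _ _
      _ = ∫⁻ x, s x * ENNReal.ofReal (c (k x) (T x)) ∂lam
            + (∫⁻ x, s x ∂lam) * ENNReal.ofReal δ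
            + (∫⁻ x, (p x - s x) ∂lam) * ENNReal.ofReal M := by
          rw [lintegral_add_left (by fun_prop), lintegral_add_left (by fun_prop),
            lintegral_mul_const _ hsE, lintegral_mul_const _ (by fun_prop)]
      _ ≤ (kernelCost (fun x y => ENNReal.ofReal (c x y)) η κ + ENNReal.ofReal δ)
            + 1 * ENNReal.ofReal δ + ENNReal.ofReal (δ / M) * ENNReal.ofReal M := by
          gcongr
          rw [hkey]
          have hk2 : kernelCost (fun x y => ENNReal.ofReal (c x y)) η κ
              = ∫⁻ x, p x * ∫⁻ y, ENNReal.ofReal (c x y) ∂(κ x) ∂lam := by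
            unfold kernelCost
            conv_lhs => rw [← hηp]
            rw [lintegral_withDensity_eq_lintegral_mul _ hpm hcκ]; rfl
          calc ∫⁻ x, ∫⁻ y, (s x : ℝ≥0∞) * ENNReal.ofReal (c (k x) y) ∂(κ x) ∂lam
              ≤ ∫⁻ x, (p x * ∫⁻ y, ENNReal.ofReal (c x y) ∂(κ x) + p x * ENNReal.ofReal δ) ∂lam := by
                refine lintegral_mono fun x => ?_
                have hcx : Measurable (fun y => ENNReal.ofReal (c x y)) :=
                  hcE.comp measurable_prodMk_left
                calc ∫⁻ y, (s x : ℝ≥0∞) * ENNReal.ofReal (c (k x) y) ∂(κ x)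
                    ≤ ∫⁻ y, p x * (ENNReal.ofReal (c x y) + ENNReal.ofReal δ) ∂(κ x) := by
                      refine lintegral_mono fun y => ?_
                      exact mul_le_mul' (hsp x) (hle2 x y)
                  _ = _ := by
                      rw [lintegral_const_mul _ (by fun_prop), lintegral_add_left hcx,
                        lintegral_const, measure_univ, mul_one, mul_add]
            _ = _ := by
                rw [lintegral_add_left (by fun_prop), ← hk2, lintegral_mul_const _ hpm, hp1,
                  one_mul]
      _ = kernelCost (fun x y => ENNReal.ofReal (c x y)) η κ + ε := by
          rw [← ENNReal.ofReal_mul (by positivity), div_mul_cancel₀ _ hM0.ne', one_mul, add_assoc,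
            add_assoc, ← ENNReal.ofReal_add hδ0.le hδ0.le, ← ENNReal.ofReal_add hδ0.le (by positivity)]
          congr 1
          rw [hδ, show ε.toReal / 3 + (ε.toReal / 3 + ε.toReal / 3) = ε.toReal by ring,
            ofReal_toReal hεt]

end
end

section
/- Let X and Y be compact Polish spaces, let μ be a d-tuple of finite nonzero Borel measures on X, let η be a Borel probability measure on X with η ∼ μ̄ such that each Radon–Nikodym derivative dμ_j/dη admits a continuous version, and let c : X×Y → [0,∞) be continuous. Let ν and ν^n (n ∈ ℕ) be d-tuples of finite Borel measures on Y such that ν^n_j ≤ ν_j for every n and j, and ν^n_j → ν_j weakly for each j (i.e., ∫_Y f dν^n_j → ∫_Y f dν_j for every bounded continuous f : Y → ℝ). Then lim_{n→∞} inf_{π ∈ Π_η(μ,ν^n)} ∫_{X×Y} c dπ = inf_{π ∈ Π_η(μ,ν)} ∫_{X×Y} c dπ, where both sides take values in [0,+∞] and an infimum over an empty set equals +∞. -/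
open MeasureTheory ProbabilityTheory ENNReal

noncomputable section

section helpers
open Filter Topology NNReal

theorem le_of_forall_bcnn {Y : Type*} [MeasurableSpace Y] [TopologicalSpace Y] [PolishSpace Y]
    [BorelSpace Y] (ν m : Measure Y) [IsFiniteMeasure ν] [IsFiniteMeasure m]
    (h : ∀ f : BoundedContinuousFunction Y ℝ≥0,
      ∫⁻ y, (f y : ℝ≥0∞) ∂ν ≤ ∫⁻ y, (f y : ℝ≥0∞) ∂m) : ν ≤ m := by
  let := TopologicalSpace.upgradeIsCompletelyMetrizable Y
  have hcl : ∀ F : Set Y, IsClosed F → ν F ≤ m F := by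
    intro F hF
    exact le_of_tendsto_of_tendsto' (HasOuterApproxClosed.tendsto_lintegral_apprSeq hF ν)
      (HasOuterApproxClosed.tendsto_lintegral_apprSeq hF m) (fun n => h _)
  refine Measure.le_iff.2 fun A hA => ?_
  rw [hA.measure_eq_iSup_isClosed_of_ne_top (measure_ne_top ν A)]
  refine iSup_le fun K => iSup_le fun hK => iSup_le fun hKc => ?_
  exact (hcl K hKc).trans (measure_mono hK)

theorem lintegral_bind_eq {X Y : Type*} [MeasurableSpace X] [MeasurableSpace Y]
    (η : Measure X) [IsProbabilityMeasure η] (μ : Measure X) (g : X → ℝ≥0∞) (hg : Measurable g)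
    (hgd : μ = η.withDensity g) (κ : Kernel X Y) [IsMarkovKernel κ] (f : Y → ℝ≥0∞)
    (hf : Measurable f) :
    ∫⁻ y, f y ∂(μ.bind (fun x => κ x)) = ∫⁻ p, g p.1 * f p.2 ∂(η.compProd κ) := by
  have hm : Measurable (fun x => ∫⁻ y, f y ∂(κ x)) := hf.lintegral_kernel
  rw [Measure.lintegral_bind κ.measurable.aemeasurable hf.aemeasurable, hgd,
    lintegral_withDensity_eq_lintegral_mul _ hg hm, Measure.lintegral_compProd (by fun_prop)]
  refine lintegral_congr fun x => ?_
  simp only [Pi.mul_apply]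
  rw [lintegral_const_mul _ hf]

theorem tendsto_tail {X : Type*} [MeasurableSpace X] (η : Measure X) (g : X → ℝ≥0∞)
    (hg : Measurable g) (hfin : ∫⁻ x, g x ∂η ≠ ∞) :
    Tendsto (fun M : ℕ => ∫⁻ x, (g x - M) ∂η) atTop (𝓝 0) := by
  have := tendsto_lintegral_of_dominated_convergence (μ := η) (F := fun (M : ℕ) x => g x - M)
    (f := fun _ => 0) g (fun M => by fun_prop) (fun M => ae_of_all _ fun x => tsub_le_self) hfin ?_
  · simpa using this
  · filter_upwards [ae_lt_top hg hfin] with x hx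
    obtain ⟨N, hN⟩ := ENNReal.exists_nat_gt hx.ne
    refine tendsto_const_nhds.congr' ?_
    filter_upwards [eventually_ge_atTop N] with M hM
    rw [eq_comm, tsub_eq_zero_iff_le]
    exact hN.le.trans (by exact_mod_cast hM)

theorem limit_ineq {X Y : Type*}
    [MeasurableSpace X] [TopologicalSpace X] [PolishSpace X] [BorelSpace X]
    [MeasurableSpace Y] [TopologicalSpace Y] [PolishSpace Y] [BorelSpace Y]
    (η : Measure X) [IsProbabilityMeasure η] (g : X → ℝ≥0∞) (hg : Continuous g)
    (hfin : ∫⁻ x, g x ∂η ≠ ∞) (l : Filter ℕ) [l.NeBot]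
    (p : ℕ → ProbabilityMeasure (X × Y)) (P : ProbabilityMeasure (X × Y))
    (hp : Tendsto p l (𝓝 P)) (hfst : ∀ᶠ n in l, (p n : Measure (X × Y)).map Prod.fst = η)
    (f : BoundedContinuousFunction Y ℝ≥0) (a : ℕ → ℝ≥0∞) (A : ℝ≥0∞) (ha : Tendsto a l (𝓝 A))
    (hle : ∀ᶠ n in l, a n ≤ ∫⁻ q, g q.1 * f q.2 ∂(p n : Measure (X × Y))) :
    A ≤ ∫⁻ q, g q.1 * f q.2 ∂(P : Measure (X × Y)) := by
  obtain ⟨C, hC⟩ : ∃ C : ℝ≥0, ∀ y, f y ≤ C := by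
    refine ⟨nndist f 0, fun y => ?_⟩
    have := f.dist_coe_le_dist (g := 0) y
    rw [← NNReal.coe_le_coe]
    simpa [NNReal.dist_eq] using this
  have hgm := hg.measurable
  have hfm : Measurable f := f.continuous.measurable
  have key : ∀ M : ℕ, A ≤ ∫⁻ q, g q.1 * f q.2 ∂(P : Measure (X × Y))
      + C * ∫⁻ x, (g x - M) ∂η := by
    intro M
    have hmin : ∀ x, min (g x) M ≠ ∞ := fun x => by simp
    have hcont : Continuous (fun q : X × Y => (min (g q.1) M).toNNReal * f q.2) := by
      refine Continuous.mul ?_ (by fun_prop)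
      refine continuous_iff_continuousAt.2 fun q => ?_
      refine (ENNReal.tendsto_toNNReal (hmin q.1)).comp ?_
      have : Continuous (fun q : X × Y => min (g q.1) (M : ℝ≥0∞)) := by fun_prop
      exact this.continuousAt
    let F : BoundedContinuousFunction (X × Y) ℝ≥0 :=
      BoundedContinuousFunction.mkOfBound ⟨_, hcont⟩ (M * C + M * C) (by
        have hb : ∀ q : X × Y, (((min (g q.1) M).toNNReal * f q.2 : ℝ≥0) : ℝ) ≤ M * C := by
          intro q
          have : (min (g q.1) M).toNNReal ≤ (M : ℝ≥0) := by
            rw [← ENNReal.coe_le_coe, ENNReal.coe_toNNReal (hmin _)]; simp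
          have := mul_le_mul' this (hC q.2)
          exact_mod_cast this
        intro x y
        rw [NNReal.dist_eq]
        have h1 := hb x
        have h2 := hb y
        have h3 := NNReal.coe_nonneg ((min (g x.1) M).toNNReal * f x.2)
        have h4 := NNReal.coe_nonneg ((min (g y.1) M).toNNReal * f y.2)
        simp only [ContinuousMap.coe_mk]
        rw [abs_le]
        constructor <;> linarith)
    have hF : ∀ q, (F q : ℝ≥0∞) = min (g q.1) M * f q.2 := by
      intro q
      change (((min (g q.1) M).toNNReal * f q.2 : ℝ≥0) : ℝ≥0∞) = _
      rw [ENNReal.coe_mul, ENNReal.coe_toNNReal (hmin _)]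
    have hlim := (ProbabilityMeasure.tendsto_iff_forall_lintegral_tendsto.1 hp F).add_const
      (C * ∫⁻ x, (g x - M) ∂η)
    refine (le_of_tendsto_of_tendsto ha hlim ?_).trans ?_
    · filter_upwards [hfst, hle] with n hn1 hn2
      refine hn2.trans ?_
      calc ∫⁻ q, g q.1 * f q.2 ∂(p n : Measure (X × Y))
          ≤ ∫⁻ q, ((F q : ℝ≥0∞) + C * (g q.1 - M)) ∂(p n : Measure (X × Y)) := by
            refine lintegral_mono fun q => ?_
            rw [hF]
            have e : g q.1 = min (g q.1) M + (g q.1 - M) := by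
              rcases le_total (g q.1) M with h | h
              · rw [min_eq_left h, tsub_eq_zero_of_le h, add_zero]
              · rw [min_eq_right h, add_tsub_cancel_of_le h]
            conv_lhs => rw [e, add_mul]
            refine add_le_add le_rfl ?_
            rw [mul_comm]
            gcongr
            exact hC _
        _ = _ := by
            rw [lintegral_add_left (by exact F.continuous.measurable.coe_nnreal_ennreal),
              lintegral_const_mul _ (by fun_prop)]
            conv_rhs => rw [← hn1, lintegral_map (by fun_prop) measurable_fst]
    · gcongr with q
      rw [hF]
      gcongr
      exact min_le_left _ _
  have ht := (ENNReal.Tendsto.const_mul (a := (C : ℝ≥0∞)) (tendsto_tail η g hgm hfin)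
    (Or.inr (by simp))).const_add (∫⁻ q, g q.1 * f q.2 ∂(P : Measure (X × Y)))
  simpa using ge_of_tendsto' ht key

end helpers

theorem stmt7 {X Y : Type*}
    [MeasurableSpace X] [TopologicalSpace X] [PolishSpace X] [BorelSpace X]
    [MeasurableSpace Y] [TopologicalSpace Y] [PolishSpace Y] [BorelSpace Y]
    [CompactSpace X] [CompactSpace Y]
    {d : ℕ} (μ : Fin d → Measure X)
    (hμfin : ∀ j, IsFiniteMeasure (μ j)) (hμ0 : ∀ j, μ j ≠ 0)
    (η : Measure X) (hη : IsProbabilityMeasure η)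
    (h1 : η ≪ avg μ) (h2 : avg μ ≪ η)
    (g : Fin d → X → ℝ≥0∞) (hgc : ∀ j, Continuous (g j))
    (hgd : ∀ j, μ j = η.withDensity (g j))
    (c : X → Y → ℝ) (hc : Continuous (Function.uncurry c))
    (hc0 : ∀ x y, 0 ≤ c x y)
    (ν : Fin d → Measure Y) (νseq : ℕ → Fin d → Measure Y)
    (hνfin : ∀ j, IsFiniteMeasure (ν j))
    (hνnfin : ∀ n j, IsFiniteMeasure (νseq n j))
    (hle : ∀ n j, νseq n j ≤ ν j)
    (hweak : ∀ j, ∀ f : BoundedContinuousFunction Y ℝ,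
      Filter.Tendsto (fun n => ∫ y, f y ∂(νseq n j)) Filter.atTop
        (nhds (∫ y, f y ∂(ν j)))) :
    Filter.Tendsto
      (fun n => ⨅ π ∈ PiSet η μ (νseq n), ∫⁻ p, ENNReal.ofReal (c p.1 p.2) ∂π)
      Filter.atTop
      (nhds (⨅ π ∈ PiSet η μ ν, ∫⁻ p, ENNReal.ofReal (c p.1 p.2) ∂π)) := by
  classical
  set V := ⨅ π ∈ PiSet η μ ν, ∫⁻ p, ENNReal.ofReal (c p.1 p.2) ∂π with hV
  have hup : ∀ n, (⨅ π ∈ PiSet η μ (νseq n), ∫⁻ p, ENNReal.ofReal (c p.1 p.2) ∂π) ≤ V := by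
    intro n
    refine iInf_le_iInf_of_subset ?_
    rintro π ⟨κ, ⟨hκ, hκ2⟩, rfl⟩
    exact ⟨κ, ⟨hκ, fun j => (hle n j).trans (hκ2 j)⟩, rfl⟩
  refine tendsto_order.2 ⟨fun a ha => ?_, fun a ha => Filter.Eventually.of_forall
    fun n => (hup n).trans_lt ha⟩
  by_contra hcon
  have hcon' : ∃ᶠ n in Filter.atTop, ¬ a < (⨅ π ∈ PiSet η μ (νseq n),
    ∫⁻ p, ENNReal.ofReal (c p.1 p.2) ∂π) := Filter.not_eventually.1 hcon
  obtain ⟨b, hab, hbV⟩ := exists_between ha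
  have hex : ∀ n, ¬ a < (⨅ π ∈ PiSet η μ (νseq n), ∫⁻ p, ENNReal.ofReal (c p.1 p.2) ∂π) →
      ∃ κ : Kernel X Y, IsSimulKernel κ μ (νseq n) ∧
        ∫⁻ p, ENNReal.ofReal (c p.1 p.2) ∂(η.compProd κ) < b := by
    intro n hn
    have := (not_lt.1 hn).trans_lt hab
    simp only [iInf_lt_iff] at this
    obtain ⟨π, ⟨κ, hκ, rfl⟩, h⟩ := this
    exact ⟨κ, hκ, h⟩
  -- default kernel
  obtain ⟨n0, hn0⟩ := hcon'.exists
  obtain ⟨κ0, ⟨hκ0, _⟩, _⟩ := hex n0 hn0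
  have hex' : ∀ n, ∃ κ : Kernel X Y, IsMarkovKernel κ ∧
      (¬ a < (⨅ π ∈ PiSet η μ (νseq n), ∫⁻ p, ENNReal.ofReal (c p.1 p.2) ∂π) →
      IsSimulKernel κ μ (νseq n) ∧
        ∫⁻ p, ENNReal.ofReal (c p.1 p.2) ∂(η.compProd κ) < b) := by
    intro n
    by_cases hn : a < (⨅ π ∈ PiSet η μ (νseq n), ∫⁻ p, ENNReal.ofReal (c p.1 p.2) ∂π)
    · exact ⟨κ0, hκ0, fun h => absurd hn h⟩
    · obtain ⟨κ, h1, h2⟩ := hex n hn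
      exact ⟨κ, h1.1, fun _ => ⟨h1, h2⟩⟩
  choose κ hκM hκ using hex'
  let p : ℕ → ProbabilityMeasure (X × Y) := fun n => ⟨η.compProd (κ n), inferInstance⟩
  let l0 : Filter ℕ := Filter.atTop ⊓ Filter.principal {n | ¬ a < (⨅ π ∈ PiSet η μ (νseq n),
    ∫⁻ p, ENNReal.ofReal (c p.1 p.2) ∂π)}
  have : l0.NeBot := Filter.frequently_mem_iff_neBot.1 hcon'
  let l : Ultrafilter ℕ := Ultrafilter.of l0
  have hl0 : (l : Filter ℕ) ≤ l0 := Ultrafilter.of_le l0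
  have hltop : (l : Filter ℕ) ≤ Filter.atTop := hl0.trans inf_le_left
  have hlbad : ∀ᶠ n in (l : Filter ℕ), ¬ a < (⨅ π ∈ PiSet η μ (νseq n),
    ∫⁻ p, ENNReal.ofReal (c p.1 p.2) ∂π) := (hl0.trans inf_le_right) (Filter.mem_principal_self _)
  obtain ⟨P, hP⟩ : ∃ P, Filter.Tendsto p l (nhds P) :=
    ⟨_, (l.map p).le_nhds_lim⟩
  have hfstn : ∀ n, (p n : Measure (X × Y)).map Prod.fst = η := fun n =>
    Measure.fst_compProd η (κ n)
  have hfst : (P : Measure (X × Y)).fst = η := by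
    have t1 := ProbabilityMeasure.tendsto_map_of_tendsto_of_continuous p P hP
      (continuous_fst (X := X) (Y := Y))
    have t2 : (fun n => (p n).map (f := Prod.fst)
        (continuous_fst (X := X) (Y := Y)).measurable.aemeasurable)
        = fun _ => (⟨η, hη⟩ : ProbabilityMeasure X) := by
      funext n
      exact Subtype.ext (hfstn n)
    rw [t2] at t1
    have := tendsto_nhds_unique t1 tendsto_const_nhds
    exact congrArg Subtype.val this
  have : Nonempty (X × Y) := nonempty_of_isProbabilityMeasure (P : Measure (X × Y))
  have : Nonempty Y := ⟨(Classical.arbitrary (X × Y)).2⟩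
  let K := (P : Measure (X × Y)).condKernel
  have hPK : η.compProd K = (P : Measure (X × Y)) := by
    conv_lhs => rw [← hfst]
    exact Measure.disintegrate _ _
  have hfin : ∀ j, ∫⁻ x, g j x ∂η ≠ ∞ := by
    intro j
    have := (hμfin j).measure_univ_lt_top
    rw [hgd j, withDensity_apply _ MeasurableSet.univ, Measure.restrict_univ] at this
    exact this.ne
  have hmem : (P : Measure (X × Y)) ∈ PiSet η μ ν := by
    refine ⟨K, ⟨inferInstance, fun j => ?_⟩, hPK.symm⟩
    have := hνfin j
    have := hμfin j
    have : IsFiniteMeasure ((μ j).bind (fun x => K x)) := by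
      refine ⟨?_⟩
      rw [Measure.bind_apply MeasurableSet.univ K.measurable.aemeasurable]
      simp
    refine le_of_forall_bcnn _ _ fun f => ?_
    have hfm : Measurable (fun y => (f y : ℝ≥0∞)) :=
      f.continuous.measurable.coe_nnreal_ennreal
    rw [lintegral_bind_eq η (μ j) (g j) (hgc j).measurable (hgd j) K _ hfm, hPK]
    have hw : Filter.Tendsto (fun n => ∫⁻ y, (f y : ℝ≥0∞) ∂(νseq n j)) Filter.atTop
        (nhds (∫⁻ y, (f y : ℝ≥0∞) ∂(ν j))) := by
      let N : FiniteMeasure Y := ⟨ν j, hνfin j⟩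
      let Ns : ℕ → FiniteMeasure Y := fun n => ⟨νseq n j, hνnfin n j⟩
      have : Filter.Tendsto Ns Filter.atTop (nhds N) :=
        FiniteMeasure.tendsto_iff_forall_integral_tendsto.2 (hweak j)
      exact FiniteMeasure.tendsto_iff_forall_lintegral_tendsto.1 this f
    refine limit_ineq η (g j) (hgc j) (hfin j) l p P hP (Filter.Eventually.of_forall hfstn) f
      _ _ (hw.mono_left hltop) ?_
    filter_upwards [hlbad] with n hn
    have h := (hκ n hn).1.2 j
    have := hκM n
    change _ ≤ ∫⁻ q, g j q.1 * f q.2 ∂(η.compProd (κ n))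
    rw [← lintegral_bind_eq η (μ j) (g j) (hgc j).measurable (hgd j) (κ n) _ hfm]
    exact lintegral_mono' h le_rfl
  have hcost : ∫⁻ q, ENNReal.ofReal (c q.1 q.2) ∂(P : Measure (X × Y)) ≤ b := by
    have hcc : Continuous (fun q : X × Y => (c q.1 q.2).toNNReal) :=
      continuous_real_toNNReal.comp hc
    have ht := ProbabilityMeasure.tendsto_iff_forall_lintegral_tendsto.1 hP
      (BoundedContinuousFunction.mkOfCompact ⟨_, hcc⟩)
    refine le_of_tendsto ht ?_
    filter_upwards [hlbad] with n hn
    exact (hκ n hn).2.le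
  exact absurd (hbV.trans_le (iInf₂_le _ hmem)) (not_lt.2 hcost)

end
end

section
/- Let X be a Polish space, let μ and ν be d-tuples of Borel probability measures on X such that K(μ,ν) and K(ν,μ) are both nonempty, and let c : X×X → [0,∞) be continuous with c(x,y) = c(y,x) for all x,y ∈ X. Then I_c(μ,ν) = I_c(ν,μ). -/
open MeasureTheory ProbabilityTheory ENNReal

noncomputable section

lemma density_exists {X : Type*} [MeasurableSpace X] (α m : Measure X)
    [IsFiniteMeasure m] (h : α ≤ m) :
    ∃ f : X → ℝ, Measurable f ∧ (∀ x, 0 ≤ f x) ∧ (∀ x, f x ≤ 1) ∧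
      α = m.withDensity (fun x => ENNReal.ofReal (f x)) := by
  have : IsFiniteMeasure α := isFiniteMeasure_of_le m h
  have hm := α.measurable_rnDeriv m
  refine ⟨fun x => min (α.rnDeriv m x).toReal 1, by fun_prop, fun x => by positivity,
    fun x => min_le_right _ _, ?_⟩
  conv_lhs => rw [← Measure.withDensity_rnDeriv_eq α m (Measure.absolutelyContinuous_of_le h)]
  apply withDensity_congr_ae
  filter_upwards [Measure.rnDeriv_le_one_of_le h] with x hx
  have hx' : α.rnDeriv m x ≤ 1 := hx
  have h2 : (α.rnDeriv m x).toReal ≤ 1 := ENNReal.toReal_le_of_le_ofReal zero_le_one (by simpa)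
  rw [min_eq_left h2, ENNReal.ofReal_toReal (ne_top_of_le_ne_top one_ne_top hx')]

lemma cross_eq {X : Type*} [MeasurableSpace X] (α m β n : Measure X)
    [IsFiniteMeasure m] (κ : Kernel X X) [IsMarkovKernel κ]
    (hβ : β = α.bind κ) (F H φ : X → ℝ≥0∞) (hF : Measurable F)
    (hH : Measurable H) (hφ : Measurable φ)
    (hα : α = m.withDensity F) (hβ' : β = n.withDensity H) :
    ∫⁻ p, φ p.2 * F p.1 ∂(m ⊗ₘ κ) = ∫⁻ y, φ y * H y ∂n := by
  calc ∫⁻ p, φ p.2 * F p.1 ∂(m ⊗ₘ κ) = ∫⁻ x, F x * ∫⁻ y, φ y ∂(κ x) ∂m := by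
        rw [Measure.lintegral_compProd (by fun_prop)]
        refine lintegral_congr fun x => ?_
        simp only
        rw [lintegral_mul_const _ hφ, mul_comm]
    _ = ∫⁻ x, ∫⁻ y, φ y ∂(κ x) ∂α := by
        rw [hα, lintegral_withDensity_eq_lintegral_mul _ hF hφ.lintegral_kernel]
        rfl
    _ = ∫⁻ y, φ y ∂β := by
        rw [hβ, Measure.lintegral_bind κ.aemeasurable hφ.aemeasurable]
    _ = _ := by
        rw [hβ', lintegral_withDensity_eq_lintegral_mul _ hH hφ]
        exact lintegral_congr fun y => mul_comm _ _

lemma key_identity {X : Type*} [MeasurableSpace X] (α m β n : Measure X)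
    [IsFiniteMeasure m] [IsFiniteMeasure n] (κ : Kernel X X) [IsMarkovKernel κ]
    (hn : n = m.bind κ) (hβ : β = α.bind κ) (f h : X → ℝ) (hf : Measurable f)
    (hh : Measurable h) (hf0 : ∀ x, 0 ≤ f x) (hh0 : ∀ x, 0 ≤ h x) (hh1 : ∀ x, h x ≤ 1)
    (hα : α = m.withDensity (fun x => ENNReal.ofReal (f x)))
    (hβ' : β = n.withDensity (fun x => ENNReal.ofReal (h x))) :
    ∫⁻ p, ENNReal.ofReal ((h p.2 - f p.1) ^ 2) ∂(m ⊗ₘ κ)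
      + ∫⁻ y, ENNReal.ofReal (h y ^ 2) ∂n = ∫⁻ x, ENNReal.ofReal (f x ^ 2) ∂m := by
  have hfin : ∫⁻ y, ENNReal.ofReal (h y ^ 2) ∂n ≠ ∞ := by
    have : ∫⁻ y, ENNReal.ofReal (h y ^ 2) ∂n ≤ ∫⁻ _, 1 ∂n := by
      refine lintegral_mono fun y => ?_
      rw [← ENNReal.ofReal_one]
      exact ENNReal.ofReal_le_ofReal (pow_le_one₀ (hh0 y) (hh1 y))
    refine ne_top_of_le_ne_top ?_ this
    simp
  have hx := cross_eq α m β n κ hβ _ _ (fun x => ENNReal.ofReal (h x))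
    (by fun_prop) (by fun_prop) (by fun_prop) hα hβ'
  have hx2 : ∫⁻ y, ENNReal.ofReal (h y) * ENNReal.ofReal (h y) ∂n
      = ∫⁻ y, ENNReal.ofReal (h y ^ 2) ∂n :=
    lintegral_congr fun y => by rw [← ENNReal.ofReal_mul (hh0 y), sq]
  rw [hx2] at hx
  have e1 : ∫⁻ p, ENNReal.ofReal (h p.2 ^ 2) ∂(m ⊗ₘ κ) = ∫⁻ y, ENNReal.ofReal (h y ^ 2) ∂n := by
    rw [hn, ← Measure.snd_compProd, Measure.snd, lintegral_map (by fun_prop) (by fun_prop)]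
  have e2 : ∫⁻ p, ENNReal.ofReal (f p.1 ^ 2) ∂(m ⊗ₘ κ) = ∫⁻ x, ENNReal.ofReal (f x ^ 2) ∂m := by
    conv_rhs => rw [← Measure.fst_compProd m κ]
    rw [Measure.fst, lintegral_map (by fun_prop) (by fun_prop)]
  have e3 : ∫⁻ p, ENNReal.ofReal ((h p.2 - f p.1) ^ 2) ∂(m ⊗ₘ κ)
      + (∫⁻ p, ENNReal.ofReal (h p.2) * ENNReal.ofReal (f p.1) ∂(m ⊗ₘ κ)
      + ∫⁻ p, ENNReal.ofReal (h p.2) * ENNReal.ofReal (f p.1) ∂(m ⊗ₘ κ))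
      = ∫⁻ p, ENNReal.ofReal (f p.1 ^ 2) ∂(m ⊗ₘ κ)
        + ∫⁻ p, ENNReal.ofReal (h p.2 ^ 2) ∂(m ⊗ₘ κ) := by
    rw [← lintegral_add_left (by fun_prop), ← lintegral_add_left (by fun_prop),
      ← lintegral_add_left (by fun_prop)]
    refine lintegral_congr fun p => ?_
    have a := hf0 p.1
    have b := hh0 p.2
    rw [← ENNReal.ofReal_mul b, ← ENNReal.ofReal_add (by positivity) (by positivity),
      ← ENNReal.ofReal_add (by positivity) (by positivity),
      ← ENNReal.ofReal_add (by positivity) (by positivity)]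
    congr 1
    ring
  rw [hx, e1, e2, ← add_assoc] at e3
  exact (ENNReal.add_left_inj hfin).1 e3

lemma bind_sum {X : Type*} [MeasurableSpace X] {d : ℕ} (μ ν : Fin d → Measure X)
    (κ : Kernel X X) (h : ∀ j, ν j = (μ j).bind κ) :
    ∑ j, ν j = (∑ j, μ j).bind κ := by
  ext s hs
  rw [Measure.bind_apply hs κ.aemeasurable, lintegral_finsetSum_measure,
    Measure.finsetSum_apply]
  refine Finset.sum_congr rfl fun j _ => ?_
  rw [h j, Measure.bind_apply hs κ.aemeasurable]

lemma simul_eq {X : Type*} [MeasurableSpace X] {d : ℕ} (μ ν : Fin d → Measure X)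
    (hμ : ∀ j, IsProbabilityMeasure (μ j)) (hν : ∀ j, IsProbabilityMeasure (ν j))
    (κ : Kernel X X) (h : IsSimulKernel κ μ ν) (j : Fin d) : ν j = (μ j).bind κ := by
  have := h.1
  refine Measure.eq_of_le_of_measure_univ_eq (h.2 j) ?_
  rw [Measure.bind_apply .univ κ.aemeasurable]
  simp

lemma swap_mem {X : Type*} [MeasurableSpace X] [StandardBorelSpace X] {d : ℕ} (hd : 0 < d)
    (μ ν : Fin d → Measure X)
    (hμ : ∀ j, IsProbabilityMeasure (μ j)) (hν : ∀ j, IsProbabilityMeasure (ν j))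
    (hKνμ : ∃ κ : Kernel X X, IsSimulKernel κ ν μ)
    (π : Measure (X × X)) (hπ : π ∈ PiSet (avg μ) μ ν) :
    π.map Prod.swap ∈ PiSet (avg ν) ν μ := by
  obtain ⟨κ, hκ, rfl⟩ := hπ
  obtain ⟨η, hη⟩ := hKνμ
  have := hκ.1
  have := hη.1
  have : Nonempty X := nonempty_of_isProbabilityMeasure (μ ⟨0, hd⟩)
  set m := ∑ j, μ j with hm
  set n := ∑ j, ν j with hn
  have hκe := simul_eq μ ν hμ hν κ hκ
  have hηe := simul_eq ν μ hν hμ η hη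
  have hnm : n = m.bind κ := bind_sum μ ν κ hκe
  have hmn : m = n.bind η := bind_sum ν μ η hηe
  have hsw : n ⊗ₘ posterior κ m = (m ⊗ₘ κ).map Prod.swap := by
    have h := compProd_posterior_eq_map_swap (κ := κ) (μ := m)
    rwa [← hnm] at h
  refine ⟨posterior κ m, ⟨inferInstance, fun j => le_of_eq ?_⟩, ?_⟩
  · have hle : μ j ≤ m := by
      rw [hm, ← Finset.add_sum_erase _ _ (Finset.mem_univ j)]
      exact Measure.le_add_right le_rfl
    have hle' : ν j ≤ n := by
      rw [hn, ← Finset.add_sum_erase _ _ (Finset.mem_univ j)]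
      exact Measure.le_add_right le_rfl
    obtain ⟨f, hf, hf0, hf1, hfd⟩ := density_exists _ _ hle
    obtain ⟨h, hh, hh0, hh1, hhd⟩ := density_exists _ _ hle'
    have k1 := key_identity _ m _ n κ hnm (hκe j) f h hf hh hf0 hh0 hh1 hfd hhd
    have k2 := key_identity _ n _ m η hmn (hηe j) h f hh hf hh0 hf0 hf1 hhd hfd
    have hfin : ∫⁻ y, ENNReal.ofReal (h y ^ 2) ∂n ≠ ∞ := by
      have : ∫⁻ y, ENNReal.ofReal (h y ^ 2) ∂n ≤ ∫⁻ _, 1 ∂n := by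
        refine lintegral_mono fun y => ?_
        rw [← ENNReal.ofReal_one]
        exact ENNReal.ofReal_le_ofReal (pow_le_one₀ (hh0 y) (hh1 y))
      refine ne_top_of_le_ne_top ?_ this
      simp
    have hz : ∫⁻ p, ENNReal.ofReal ((h p.2 - f p.1) ^ 2) ∂(m ⊗ₘ κ) = 0 := by
      have hl : ∫⁻ p, ENNReal.ofReal ((h p.2 - f p.1) ^ 2) ∂(m ⊗ₘ κ)
          + ∫⁻ y, ENNReal.ofReal (h y ^ 2) ∂n ≤ 0 + ∫⁻ y, ENNReal.ofReal (h y ^ 2) ∂n := by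
        rw [k1, zero_add, ← k2]
        exact le_add_self
      exact le_antisymm ((ENNReal.add_le_add_iff_right hfin).1 hl) zero_le
    rw [lintegral_eq_zero_iff (by fun_prop)] at hz
    have hae : ∀ᵐ p ∂(m ⊗ₘ κ), h p.2 = f p.1 := by
      filter_upwards [hz] with p hp
      have hp' : (h p.2 - f p.1) ^ 2 ≤ 0 := ENNReal.ofReal_eq_zero.1 hp
      nlinarith [pow_eq_zero_iff (two_ne_zero) |>.1 (le_antisymm hp' (sq_nonneg _))]
    ext s hs
    have hφ : Measurable (s.indicator (1 : X → ℝ≥0∞)) := measurable_one.indicator hs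
    have hk := Kernel.measurable_coe (posterior κ m) hs
    symm
    calc (ν j).bind (posterior κ m) s = ∫⁻ y, posterior κ m y s ∂(ν j) :=
          Measure.bind_apply hs (Kernel.aemeasurable _)
      _ = ∫⁻ y, ENNReal.ofReal (h y) * posterior κ m y s ∂n := by
          conv_lhs => rw [hhd]
          rw [lintegral_withDensity_eq_lintegral_mul _ (by fun_prop) hk]
          rfl
      _ = ∫⁻ p, ENNReal.ofReal (h p.1) * s.indicator 1 p.2 ∂(n ⊗ₘ posterior κ m) := by
          rw [Measure.lintegral_compProd (by fun_prop)]
          refine lintegral_congr fun y => ?_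
          simp only
          rw [lintegral_const_mul _ hφ, lintegral_indicator_one hs]
      _ = ∫⁻ p, ENNReal.ofReal (h p.2) * s.indicator 1 p.1 ∂(m ⊗ₘ κ) := by
          rw [hsw, lintegral_map (by fun_prop) measurable_swap]
          rfl
      _ = ∫⁻ p, ENNReal.ofReal (f p.1) * s.indicator 1 p.1 ∂(m ⊗ₘ κ) := by
          refine lintegral_congr_ae ?_
          filter_upwards [hae] with p hp
          rw [hp]
      _ = ∫⁻ x, ENNReal.ofReal (f x) * s.indicator 1 x ∂m := by
          conv_rhs => rw [← Measure.fst_compProd m κ]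
          rw [Measure.fst, lintegral_map (by fun_prop) (by fun_prop)]
      _ = ∫⁻ x, s.indicator 1 x ∂(μ j) := by
          conv_rhs => rw [hfd]
          rw [lintegral_withDensity_eq_lintegral_mul _ (by fun_prop) hφ]
          rfl
      _ = μ j s := lintegral_indicator_one hs
  · have hu : n Set.univ = m Set.univ := by
      simp [hm, hn, Measure.finsetSum_apply]
    unfold avg
    rw [← hm, ← hn, hu, Measure.compProd_smul_left, Measure.compProd_smul_left, hsw,
      Measure.map_smul]

theorem stmt14 {X : Type*}
    [MeasurableSpace X] [TopologicalSpace X] [PolishSpace X] [BorelSpace X]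
    {d : ℕ} (hd : 0 < d)
    (μ ν : Fin d → Measure X)
    (hμ : ∀ j, IsProbabilityMeasure (μ j)) (hν : ∀ j, IsProbabilityMeasure (ν j))
    (hKμν : ∃ κ : Kernel X X, IsSimulKernel κ μ ν)
    (hKνμ : ∃ κ : Kernel X X, IsSimulKernel κ ν μ)
    (c : X → X → ℝ) (hc : Continuous (Function.uncurry c))
    (hc0 : ∀ x y, 0 ≤ c x y) (hsymm : ∀ x y, c x y = c y x) :
    (⨅ π ∈ PiSet (avg μ) μ ν, ∫⁻ p, ENNReal.ofReal (c p.1 p.2) ∂π) =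
      ⨅ π ∈ PiSet (avg ν) ν μ, ∫⁻ p, ENNReal.ofReal (c p.1 p.2) ∂π := by
  have key : ∀ (μ ν : Fin d → Measure X), (∀ j, IsProbabilityMeasure (μ j)) →
      (∀ j, IsProbabilityMeasure (ν j)) → (∃ κ : Kernel X X, IsSimulKernel κ ν μ) →
      (⨅ π ∈ PiSet (avg ν) ν μ, ∫⁻ p, ENNReal.ofReal (c p.1 p.2) ∂π) ≤
      ⨅ π ∈ PiSet (avg μ) μ ν, ∫⁻ p, ENNReal.ofReal (c p.1 p.2) ∂π := by
    intro μ ν hμ hν hK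
    refine le_iInf₂ fun π hπ => ?_
    refine (iInf₂_le _ (swap_mem hd μ ν hμ hν hK π hπ)).trans (le_of_eq ?_)
    have hcm : Measurable fun p : X × X => ENNReal.ofReal (c p.1 p.2) :=
      hc.measurable.ennreal_ofReal
    rw [lintegral_map hcm measurable_swap]
    exact lintegral_congr fun p => by simp [hsymm p.2 p.1]
  exact le_antisymm (key ν μ hν hμ hKμν) (key μ ν hμ hν hKνμ)

end
end
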